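/- arXiv:1911.13284 — 5 statements merged into one kernel-verified Lean document; each statement's English description precedes it below -/
import Mathlib

section
/- Let n ≥ 5 and let G = A_n be the alternating group on n letters. Then for every faithful irreducible character α of G, diam M(G,α) ≤ 4n−4; that is, for all irreducible characters χ₁, χ₂ of G there exists an integer j with 0 ≤ j ≤ 4n−4 such that [α^j·χ₁, χ₂]_G ≠ 0. -/
open scoped BigOperators

/-- The inner product `[φ,ψ]_G = (1/|G|) ∑_{g∈G} φ(g)·conj(ψ(g))` of two complex-valued
functions on a group `G`. -/
noncomputable def charInner {G : Type} [Group G] (φ ψ : G → ℂ) : ℂ :=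
  (Nat.card G : ℂ)⁻¹ * ∑ᶠ g : G, φ g * (starRingEnd ℂ) (ψ g)

/-- `χ` is the character of some finite-dimensional complex representation of `G`. -/
def IsChar (G : Type) [Group G] (χ : G → ℂ) : Prop :=
  ∃ V : FDRep ℂ G, ∀ g, V.character g = χ g

/-- `χ` is the character of some irreducible finite-dimensional complex representation of `G`. -/
def IsIrrChar (G : Type) [Group G] (χ : G → ℂ) : Prop :=
  ∃ V : FDRep ℂ G, CategoryTheory.Simple V ∧ ∀ g, V.character g = χ g

/-- `χ` is a character of `G` afforded by a faithful (injective) representation. -/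
def IsFaithfulChar (G : Type) [Group G] (χ : G → ℂ) : Prop :=
  ∃ V : FDRep ℂ G, Function.Injective (fun g => V.ρ g) ∧ ∀ g, V.character g = χ g

/-- The McKay graph `M(G, α)` has diameter at most `d`: for every ordered pair of
irreducible characters `χ₁, χ₂` there is `0 ≤ j ≤ d` with `[α^j·χ₁, χ₂]_G ≠ 0`. -/
def McKayDiamLE (G : Type) [Group G] (α : G → ℂ) (d : ℕ) : Prop :=
  ∀ χ₁ χ₂ : G → ℂ, IsIrrChar G χ₁ → IsIrrChar G χ₂ →
    ∃ j ≤ d, charInner (α ^ j * χ₁) χ₂ ≠ 0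

/-- `f` is a matrix coefficient of some finite-dimensional representation affording `χ`. -/
def IsMatrixCoeff {G : Type} [Group G] (χ f : G → ℂ) : Prop :=
  ∃ (V : Type) (_ : AddCommGroup V) (_ : Module ℂ V) (_ : FiniteDimensional ℂ V)
    (ρ : Representation ℂ G V) (v : V) (l : Module.Dual ℂ V),
    (∀ g, ρ.character g = χ g) ∧ ∀ g, f g = l (ρ g v)

namespace IsMatrixCoeff

variable {G : Type} [Group G]

theorem mul {χ f ψ h : G → ℂ} (hf : IsMatrixCoeff χ f) (hh : IsMatrixCoeff ψ h) :
    IsMatrixCoeff (χ * ψ) (f * h) := by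
  obtain ⟨V, _, _, _, ρ, v, l, hχ, hl⟩ := hf
  obtain ⟨W, _, _, _, σ, w, m, hψ, hm⟩ := hh
  refine ⟨TensorProduct ℂ V W, inferInstance, inferInstance, inferInstance, ρ.tprod σ,
    v ⊗ₜ[ℂ] w, LinearMap.mul' ℂ ℂ ∘ₗ TensorProduct.map l m, fun g => ?_, fun g => ?_⟩
  · rw [Representation.char_tensor]
    simp [hχ, hψ]
  · simp [hl, hm, Representation.tprod_apply]

/-- If the representation affording `χ` has no nonzero invariants, then every matrix coefficient
of it sums to zero. -/
theorem sum_eq_zero [Fintype G] {χ f : G → ℂ} (hf : IsMatrixCoeff χ f) (hχ : ∑ g, χ g = 0) :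
    ∑ g, f g = 0 := by
  obtain ⟨V, _, _, _, ρ, v, l, hχ', hl⟩ := hf
  have : Invertible (Nat.card G : ℂ) := invertibleOfNonzero (by simp)
  have h := ρ.card_inv_mul_sum_char_eq_finrank
  simp only [hχ', hχ, mul_zero] at h
  have h0 : Module.finrank ℂ ρ.invariants = 0 := by exact_mod_cast h.symm
  have hbot : ρ.invariants = ⊥ := Submodule.finrank_eq_zero.mp h0
  have hmem : ∑ g, ρ g v ∈ ρ.invariants := by
    intro a
    rw [map_sum]
    exact Fintype.sum_equiv (Equiv.mulLeft a) _ _ fun g => by simp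
  rw [hbot, Submodule.mem_bot] at hmem
  simp only [hl, ← map_sum, hmem, map_zero]

theorem exists_apply_one_eq_one {V : Type} [AddCommGroup V] [Module ℂ V] [FiniteDimensional ℂ V]
    [Nontrivial V] (ρ : Representation ℂ G V) : ∃ f, IsMatrixCoeff ρ.character f ∧ f 1 = 1 := by
  obtain ⟨v, hv⟩ := exists_ne (0 : V)
  obtain ⟨l, hl⟩ := Module.Projective.exists_dual_eq_one ℂ hv
  exact ⟨fun g => l (ρ g v), ⟨V, _, _, inferInstance, ρ, v, l, fun _ => rfl, fun _ => rfl⟩,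
    by simp [hl]⟩

end IsMatrixCoeff

/-- The complex conjugate of a character is a character. -/
theorem Representation.exists_character_eq_conj {G : Type} [Group G] {V : Type} [AddCommGroup V]
    [Module ℂ V] [FiniteDimensional ℂ V] (ρ : Representation ℂ G V) :
    ∃ σ : Representation ℂ G (Fin (Module.finrank ℂ V) → ℂ),
      ∀ g, σ.character g = (starRingEnd ℂ) (ρ.character g) := by
  let b := Module.finBasis ℂ V
  let M : (V →ₗ[ℂ] V) →* Matrix _ _ ℂ := (LinearMap.toMatrixAlgEquiv b).toMulEquiv.toMonoidHom
  let C : Matrix (Fin (Module.finrank ℂ V)) (Fin (Module.finrank ℂ V)) ℂ →* Matrix _ _ ℂ :=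
    (starRingEnd ℂ).mapMatrix.toMonoidHom
  let L : Matrix (Fin (Module.finrank ℂ V)) (Fin (Module.finrank ℂ V)) ℂ →* _ :=
    (Matrix.toLinAlgEquiv' (R := ℂ)).toMulEquiv.toMonoidHom
  refine ⟨L.comp (C.comp (M.comp ρ)), fun g => ?_⟩
  rw [Representation.character, Representation.character, LinearMap.trace_eq_matrix_trace ℂ b]
  change LinearMap.trace ℂ _
    (Matrix.toLin' ((LinearMap.toMatrix b b (ρ g)).map (starRingEnd ℂ))) = _
  rw [Matrix.trace_toLin'_eq, ← AddMonoidHom.map_trace]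

theorem alternatingGroup.exists_apply_eq_apply_eq {n : ℕ} (hn : 4 ≤ n) {a b c d : Fin n}
    (hab : a ≠ b) (hcd : c ≠ d) :
    ∃ g : alternatingGroup (Fin n), g.1 a = c ∧ g.1 b = d := by
  have h := alternatingGroup.isMultiplyPretransitive (Fin n)
  have h2 : MulAction.IsMultiplyPretransitive (alternatingGroup (Fin n)) (Fin n) 2 :=
    MulAction.isMultiplyPretransitive_of_le' (n := Nat.card (Fin n) - 2) (by simp; omega) (by simp)
  exact MulAction.is_two_pretransitive_iff.mp h2 hab hcd

theorem alternatingGroup.exists_apply_eq {n : ℕ} (hn : 4 ≤ n) (a c : Fin n) :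
    ∃ g : alternatingGroup (Fin n), g.1 a = c := by
  have : Nontrivial (Fin n) := Fin.nontrivial_iff_two_le.mpr (by omega)
  obtain ⟨b, hb⟩ := exists_ne a
  obtain ⟨d, hd⟩ := exists_ne c
  obtain ⟨g, hg, -⟩ := exists_apply_eq_apply_eq hn hb.symm hd.symm
  exact ⟨g, hg⟩

/-- If a representation affording `χ` contains a nonconstant equivariant family indexed by the
natural `A_n`-set, then up to an additive constant the indicator function of each point stabilizer
is a matrix coefficient of `χ`. -/
theorem exists_isMatrixCoeff_stabilizer {n : ℕ} (hn : 4 ≤ n) {Y : Type} [AddCommGroup Y]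
    [Module ℂ Y] [FiniteDimensional ℂ Y] (ρ : Representation ℂ (alternatingGroup (Fin n)) Y)
    (y : Fin n → Y) (hy : ∀ g a, ρ g (y a) = y (g.1 a)) (hne : ∃ a b, y a ≠ y b) (a : Fin n) :
    ∃ f q, IsMatrixCoeff ρ.character f ∧
      ∀ g : alternatingGroup (Fin n), (if g.1 a = a then (1 : ℂ) else 0) = f g + q := by
  suffices ∃ (l : Module.Dual ℂ Y) (q : ℂ), ∀ b, (if b = a then (1 : ℂ) else 0) = l (y b) + q by
    obtain ⟨l, q, h⟩ := this
    refine ⟨fun g => l (ρ g (y a)), q, ⟨Y, _, _, inferInstance, ρ, y a, l, fun _ => rfl,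
      fun _ => rfl⟩, fun g => ?_⟩
    simpa only [hy] using h (g.1 a)
  obtain ⟨c, d, hcd⟩ := hne
  obtain ⟨l₀, hl₀⟩ := Module.Projective.exists_dual_ne_zero ℂ (sub_ne_zero.mpr hcd)
  rw [map_sub, sub_ne_zero] at hl₀
  obtain ⟨a₀, ha₀⟩ : ∃ a₀, (n : ℂ) * l₀ (y a₀) ≠ ∑ b, l₀ (y b) := by
    by_contra! h
    exact hl₀ (mul_left_cancel₀ (Nat.cast_ne_zero.mpr (by omega)) ((h c).trans (h d).symm))
  obtain ⟨h, hh⟩ := alternatingGroup.exists_apply_eq hn a a₀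
  let l₁ : Module.Dual ℂ Y := l₀ ∘ₗ ρ h
  have hl₁ : ∀ b, l₁ (y b) = l₀ (y (h.1 b)) := fun b => by simp [l₁, hy]
  have hs₁ : (n : ℂ) * l₁ (y a) ≠ ∑ b, l₁ (y b) := by
    simp_rw [hl₁, hh]
    rwa [Equiv.sum_comp h.1 fun b => l₀ (y b)]
  let H : Finset (alternatingGroup (Fin n)) := Finset.univ.filter fun g => g.1 a = a
  let l₂ : Module.Dual ℂ Y := ∑ g ∈ H, l₁ ∘ₗ ρ g
  have hl₂ : ∀ b, l₂ (y b) = ∑ g ∈ H, l₁ (y (g.1 b)) := fun b => by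
    simp [l₂, LinearMap.sum_apply, hy]
  have hinv : ∀ k : alternatingGroup (Fin n), k.1 a = a → ∀ b, l₂ (y (k.1 b)) = l₂ (y b) := by
    intro k hk b
    rw [hl₂, hl₂]
    refine Finset.sum_equiv (Equiv.mulRight k) (fun g => ?_) fun g _ => by simp
    simp [H, hk]
  have hHa : l₂ (y a) = H.card * l₁ (y a) := by
    rw [hl₂, Finset.sum_congr rfl (g := fun _ => l₁ (y a)) fun g hg => by
      rw [(Finset.mem_filter.mp hg).2]]
    simp
  have hHs : ∑ b, l₂ (y b) = H.card * ∑ b, l₁ (y b) := by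
    simp_rw [hl₂]
    rw [Finset.sum_comm, Finset.sum_congr rfl fun g _ => Equiv.sum_comp g.1 fun b => l₁ (y b)]
    simp
  have hH : (H.card : ℂ) ≠ 0 := by
    have : (1 : alternatingGroup (Fin n)) ∈ H := by simp [H]
    exact_mod_cast (Finset.card_pos.mpr ⟨_, this⟩).ne'
  have : Nontrivial (Fin n) := Fin.nontrivial_iff_two_le.mpr (by omega)
  obtain ⟨e, he⟩ := exists_ne a
  have hC : ∀ b, b ≠ a → l₂ (y b) = l₂ (y e) := by
    intro b hb
    obtain ⟨k, hka, hkb⟩ := alternatingGroup.exists_apply_eq_apply_eq hn he.symm hb.symm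
    rw [← hkb, hinv k hka]
  have hdiff : l₂ (y a) - l₂ (y e) ≠ 0 := by
    rw [sub_ne_zero]
    intro heq
    have hall : ∀ b, l₂ (y b) = l₂ (y a) := fun b => by
      by_cases hb : b = a
      · rw [hb]
      · rw [hC b hb, heq]
    rw [Finset.sum_congr rfl fun b _ => hall b, hHa] at hHs
    simp only [Finset.sum_const, Finset.card_univ, Fintype.card_fin, nsmul_eq_mul] at hHs
    exact hs₁ (mul_left_cancel₀ hH (by linear_combination hHs))
  refine ⟨(l₂ (y a) - l₂ (y e))⁻¹ • l₂, -(l₂ (y a) - l₂ (y e))⁻¹ * l₂ (y e), fun b => ?_⟩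
  by_cases hb : b = a
  · simp only [hb, if_true, LinearMap.smul_apply, smul_eq_mul]
    field_simp
    ring
  · simp only [hb, if_false, LinearMap.smul_apply, smul_eq_mul, hC b hb]
    ring

/-- If certain functions are, up to additive constants, matrix coefficients of `ψ`, then the
products of at most `m` of them are orthogonal to the matrix coefficients of `θ`, provided that none
of `θ, ψ θ, …, ψ ^ m θ` contains the trivial character. -/
theorem sum_mul_prod_eq_zero {G ι : Type} [Group G] [Fintype G] {ψ θ : G → ℂ} {m : ℕ}
    (hzero : ∀ i ≤ m, ∑ g, (ψ ^ i * θ) g = 0) (e : ι → G → ℂ)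
    (he : ∀ a, ∃ f q, IsMatrixCoeff ψ f ∧ ∀ g, e a g = f g + q) (s : Finset ι) :
    ∀ i F, i + s.card ≤ m → IsMatrixCoeff (ψ ^ i * θ) F → ∑ g, F g * ∏ a ∈ s, e a g = 0 := by
  classical
  induction s using Finset.induction_on with
  | empty =>
    intro i F hi hF
    simpa using hF.sum_eq_zero (hzero i (by simpa using hi))
  | insert a s ha ih =>
    intro i F hi hF
    rw [Finset.card_insert_of_notMem ha] at hi
    obtain ⟨f, q, hf, hfq⟩ := he a
    have h₁ := ih (i + 1) (f * F) (by omega) (by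
      rw [pow_succ', mul_assoc]
      exact hf.mul hF)
    have h₂ := ih i F (by omega) hF
    calc ∑ g, F g * ∏ b ∈ insert a s, e b g
        = ∑ g, ((f * F) g * ∏ b ∈ s, e b g + q * (F g * ∏ b ∈ s, e b g)) := by
          refine Finset.sum_congr rfl fun g _ => ?_
          rw [Finset.prod_insert ha, hfq, Pi.mul_apply]
          ring
      _ = 0 := by rw [Finset.sum_add_distrib, ← Finset.mul_sum, h₁, h₂, mul_zero, add_zero]

theorem Equiv.Perm.eq_one_of_forall_ne {ι : Type*} {g : Equiv.Perm ι} {c : ι}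
    (h : ∀ a, a ≠ c → g a = a) : g = 1 := by
  ext a
  by_cases ha : a = c
  · subst ha
    by_contra hne
    exact hne (g.injective (h _ hne))
  · simp [h a ha]

theorem FDRep.nontrivial_of_simple {G : Type} [Group G] [Fintype G] (V : FDRep ℂ G)
    [hV : CategoryTheory.Simple V] : Nontrivial V := by
  rw [FDRep.simple_iff_char_is_norm_one] at hV
  by_contra h
  rw [not_nontrivial_iff_subsingleton] at h
  have h0 : ∀ g, V.character g = 0 := fun g => by
    rw [FDRep.character, Subsingleton.elim (V.ρ g) 0, map_zero]
  simp only [h0, mul_zero, Finset.sum_const_zero] at hV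
  exact Nat.cast_ne_zero.mpr Nat.card_pos.ne' hV.symm

/-- A power of `χ` containing a nonconstant equivariant family indexed by the natural
`A_n`-set bounds the diameter of the McKay graph of `χ`. -/
theorem mcKayDiamLE_of_equivariant {n : ℕ} (hn : 4 ≤ n) {Y : Type} [AddCommGroup Y]
    [Module ℂ Y] [FiniteDimensional ℂ Y] (ρ : Representation ℂ (alternatingGroup (Fin n)) Y)
    (y : Fin n → Y) (hy : ∀ g a, ρ g (y a) = y (g.1 a)) (hne : ∃ a b, y a ≠ y b)
    {α : alternatingGroup (Fin n) → ℂ} {k : ℕ} (hα : ρ.character = α ^ k) :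
    McKayDiamLE (alternatingGroup (Fin n)) α (k * (n - 1)) := by
  rintro χ₁ χ₂ ⟨V, _, hV⟩ ⟨W, _, hW⟩
  by_contra! hzero
  have := V.nontrivial_of_simple
  have := W.nontrivial_of_simple
  obtain ⟨σ, hσ⟩ := Representation.exists_character_eq_conj W.ρ
  obtain ⟨f₁, hf₁, hf₁'⟩ := IsMatrixCoeff.exists_apply_one_eq_one V.ρ
  have : Nonempty (Fin (Module.finrank ℂ W)) := ⟨⟨0, Module.finrank_pos⟩⟩
  obtain ⟨f₂, hf₂, hf₂'⟩ := IsMatrixCoeff.exists_apply_one_eq_one σ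
  let c : Fin n := ⟨0, by omega⟩
  have key := sum_mul_prod_eq_zero (ψ := ρ.character)
    (θ := Representation.character V.ρ * σ.character)
    (m := n - 1) (fun i hi => ?_)
    (fun a (g : alternatingGroup (Fin n)) => if g.1 a = a then (1 : ℂ) else 0)
    (exists_isMatrixCoeff_stabilizer hn ρ y hy hne) (Finset.univ.erase c) 0 (f₁ * f₂)
    (by simp) (by simpa using hf₁.mul hf₂)
  · rw [Finset.sum_eq_single 1] at key
    · simp [hf₁', hf₂'] at key
    · intro g _ hg
      rw [Finset.prod_boole, if_neg, mul_zero]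
      intro h
      exact hg (Subtype.ext
        (Equiv.Perm.eq_one_of_forall_ne (c := c) fun a ha => h a (by simp [ha])))
    · simp
  · have h := hzero (k * i) (Nat.mul_le_mul_left k hi)
    rw [charInner, finsum_eq_sum_of_fintype] at h
    rw [hα]
    rcases mul_eq_zero.mp h with h | h
    · exact absurd h (inv_ne_zero (Nat.cast_ne_zero.mpr Nat.card_pos.ne'))
    · rw [← h]
      refine Finset.sum_congr rfl fun g _ => ?_
      have hV' : Representation.character V.ρ g = χ₁ g := hV g
      have hW' : Representation.character W.ρ g = χ₂ g := hW g
      simp [pow_mul, hV', hσ, hW', mul_assoc]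

theorem Finset.sum_univ_eq_add_sum_sub {ι : Type*} [Fintype ι] [DecidableEq ι] (s : Finset ι)
    {g h : ι → ℂ} (hgh : ∀ c, c ∉ s → g c = h c) : ∑ c, g c = ∑ c, h c + ∑ c ∈ s, (g c - h c) := by
  rw [Finset.sum_subset (Finset.subset_univ s) fun c _ hc => sub_eq_zero.mpr (hgh c hc),
    Finset.sum_sub_distrib]
  ring

/-- The sum of the translates of a function of three points under the transpositions moving `a`. -/
noncomputable def swapSum {n : ℕ} (a : Fin n) (f : Fin n → Fin n → Fin n → ℂ) (i j k : Fin n) : ℂ :=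
  ∑ c ∈ Finset.univ.erase a, f (Equiv.swap a c i) (Equiv.swap a c j) (Equiv.swap a c k)

theorem swapSum_eq {n : ℕ} (a : Fin n) (f : Fin n → Fin n → Fin n → ℂ) (i j k : Fin n) :
    swapSum a f i j k =
      ∑ c, f (Equiv.swap a c i) (Equiv.swap a c j) (Equiv.swap a c k) - f i j k := by
  rw [swapSum, ← Finset.sum_erase_add _ _ (Finset.mem_univ a)]
  simp

/-- Functions of three points which vanish on triples with repetitions and transform under
permutations of the arguments by the trivial character (`ε = 1`) or the sign (`ε = -1`). -/
structure IsSignSymm {n : ℕ} (ε : ℂ) (f : Fin n → Fin n → Fin n → ℂ) : Prop where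
  cyc : ∀ i j k, f i j k = f j k i
  swap : ∀ i j k, f i k j = ε * f i j k
  diag : ∀ i k, f i i k = 0

namespace IsSignSymm

variable {n : ℕ} {ε : ℂ} {f p : Fin n → Fin n → Fin n → ℂ}

theorem diag₁₃ (hf : IsSignSymm ε f) (i k : Fin n) : f i k i = 0 := by
  rw [← hf.cyc, hf.diag]

theorem swap₁₂ (hf : IsSignSymm ε f) (i j k : Fin n) : f j i k = ε * f i j k := by
  rw [hf.cyc, hf.swap]

theorem swap₁₃ (hf : IsSignSymm ε f) (i j k : Fin n) : f k j i = ε * f i j k := by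
  rw [← hf.cyc, hf.swap]

theorem swapSum (hf : IsSignSymm ε f) (a : Fin n) : IsSignSymm ε (swapSum a f) where
  cyc i j k := Finset.sum_congr rfl fun c _ => hf.cyc _ _ _
  swap i j k := by
    rw [_root_.swapSum, _root_.swapSum, Finset.mul_sum]
    exact Finset.sum_congr rfl fun c _ => hf.swap _ _ _
  diag i k := Finset.sum_eq_zero fun c _ => hf.diag _ _

theorem swapSum_apply_self (hf : IsSignSymm ε f) {i j k : Fin n} (hij : i ≠ j) (hik : i ≠ k)
    (hjk : j ≠ k) : _root_.swapSum i f i j k = (2 * ε - 1) * f i j k + ∑ c, f c j k := by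
  rw [swapSum_eq, Finset.sum_univ_eq_add_sum_sub {j, k} (h := fun c => f c j k)]
  · rw [Finset.sum_pair hjk]
    simp only [Equiv.swap_apply_left, Equiv.swap_apply_right,
      Equiv.swap_apply_of_ne_of_ne hik.symm hjk.symm, Equiv.swap_apply_of_ne_of_ne hij.symm hjk,
      hf.diag, hf.diag₁₃, hf.swap₁₂ i j k, hf.swap₁₃ i j k]
    ring
  · intro c hc
    simp only [Finset.mem_insert, Finset.mem_singleton, not_or] at hc
    rw [Equiv.swap_apply_left, Equiv.swap_apply_of_ne_of_ne hij.symm (Ne.symm hc.1),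
      Equiv.swap_apply_of_ne_of_ne hik.symm (Ne.symm hc.2)]

theorem swapSum_apply_of_ne {a i j k : Fin n} (hij : i ≠ j) (hik : i ≠ k)
    (hjk : j ≠ k) (hai : a ≠ i) (haj : a ≠ j) (hak : a ≠ k) :
    _root_.swapSum a f i j k = f a j k + f i a k + f i j a + (n - 4) * f i j k := by
  rw [swapSum_eq, Finset.sum_univ_eq_add_sum_sub {i, j, k} (h := fun _ => f i j k)]
  · rw [Finset.sum_insert (by simp [hij, hik]), Finset.sum_pair hjk]
    simp only [Equiv.swap_apply_right,
      Equiv.swap_apply_of_ne_of_ne hak.symm hik.symm,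
      Equiv.swap_apply_of_ne_of_ne haj.symm hij.symm,
      Equiv.swap_apply_of_ne_of_ne hai.symm hij, Equiv.swap_apply_of_ne_of_ne hai.symm hik,
      Equiv.swap_apply_of_ne_of_ne haj.symm hjk, Equiv.swap_apply_of_ne_of_ne hak.symm hjk.symm,
      Finset.sum_const, Finset.card_univ, Fintype.card_fin, nsmul_eq_mul]
    ring
  · intro c hc
    simp only [Finset.mem_insert, Finset.mem_singleton, not_or] at hc
    rw [Equiv.swap_apply_of_ne_of_ne hai.symm (Ne.symm hc.1),
      Equiv.swap_apply_of_ne_of_ne haj.symm (Ne.symm hc.2.1),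
      Equiv.swap_apply_of_ne_of_ne hak.symm (Ne.symm hc.2.2)]

theorem swapSum_swapSum_apply_self (hp : IsSignSymm ε p) (hε : ε ^ 2 = 1) {i j k : Fin n}
    (hij : i ≠ j) (hik : i ≠ k) (hjk : j ≠ k) :
    _root_.swapSum i (_root_.swapSum i p) i j k = (5 - 4 * ε) * p i j k +
      (n - 4 + 2 * ε) * ∑ c, p c j k + ∑ c, p c i k + ∑ c, p c j i := by
  have hq := hp.swapSum i
  rw [hq.swapSum_apply_self hij hik hjk, Finset.sum_univ_eq_add_sum_sub {i, j, k}
    (h := fun c => p i j k + p c i k + p c j i + (n - 4) * p c j k)]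
  · rw [Finset.sum_insert (by simp [hij, hik]), Finset.sum_pair hjk]
    simp only [hq.diag, hq.diag₁₃, hp.diag, hp.diag₁₃, hp.swapSum_apply_self hij hik hjk,
      Finset.sum_add_distrib, ← Finset.mul_sum, hp.swap₁₂ i j k, hp.swap₁₃ i j k,
      Finset.sum_const, Finset.card_univ, Fintype.card_fin, nsmul_eq_mul]
    linear_combination 4 * p i j k * hε
  · intro c hc
    simp only [Finset.mem_insert, Finset.mem_singleton, not_or] at hc
    rw [swapSum_apply_of_ne hc.2.1 hc.2.2 hjk (Ne.symm hc.1) hij hik]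

/-- If the second `swapSum` of a symmetric or antisymmetric function of three points does not depend
on the base point, then the function is constant on triples of distinct points. -/
theorem exists_eq_const (hn : 5 ≤ n) (hp : IsSignSymm ε p) (hε : ε ^ 2 = 1)
    (hD : ∀ a b i j k, _root_.swapSum a (_root_.swapSum a p) i j k =
      _root_.swapSum b (_root_.swapSum b p) i j k)
    (hnε : (n : ℂ) - 4 + ε ≠ 0)
    (hcoef : ((n : ℂ) - 3) * (5 - 4 * ε) + 3 * (n - 5 + 2 * ε) - (n - 3) * (n - 4) ^ 2 ≠ 0) :
    ∃ C, ∀ i j k, i ≠ j → i ≠ k → j ≠ k → p i j k = C := by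
  have hex : ∀ s : Finset (Fin n), s.card ≤ 4 → ∃ m, m ∉ s := fun s hs => by
    by_contra! h
    have := Finset.card_le_card (Finset.subset_univ s)
    rw [Finset.eq_univ_of_forall h] at hs
    simp at hs
    omega
  let P : Fin n → Fin n → ℂ := fun j k => ∑ c, p c j k
  have hP : ∀ j k, P k j = ε * P j k := fun j k => by
    simp only [P, Finset.mul_sum]
    exact Finset.sum_congr rfl fun c _ => hp.swap _ _ _
  have hrot : ∀ i j k, i ≠ j → i ≠ k → j ≠ k → P j k = P k i := by
    intro i j k hij hik hjk
    have h₁ := hp.swapSum_swapSum_apply_self hε hij hik hjk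
    have h₂ := hp.swapSum_swapSum_apply_self hε hjk hij.symm hik.symm
    rw [← hp.cyc, ← ((hp.swapSum j).swapSum j).cyc, ← hD i] at h₂
    change _ = _ + _ * P j k + P i k + P j i at h₁
    change _ = _ + _ * P k i + P j i + P k j at h₂
    rw [hP k i] at h₁
    rw [hP j k] at h₂
    exact mul_left_cancel₀ hnε (by linear_combination h₂ - h₁)
  obtain ⟨c, hc⟩ : ∃ c, ∀ j k, j ≠ k → P j k = c := by
    let z : Fin n := ⟨0, by omega⟩
    let o : Fin n := ⟨1, by omega⟩
    have hzo : z ≠ o := by simp [z, o]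
    refine ⟨P z o, fun j k hjk => ?_⟩
    obtain ⟨m, hm⟩ := hex {j, k, z, o} Finset.card_le_four
    obtain ⟨x, hx⟩ := hex {k, o, m} (Finset.card_le_three.trans (by norm_num))
    simp only [Finset.mem_insert, Finset.mem_singleton, not_or] at hm hx
    rw [hrot m j k hm.1 hm.2.1 hjk, hrot x k m hx.1 hx.2.2 (Ne.symm hm.2.1),
      hrot m z o hm.2.2.1 hm.2.2.2 hzo, hrot x o m hx.2.1 hx.2.2 (Ne.symm hm.2.2.2)]
  refine ⟨_, fun i j k hij hik hjk => eq_div_of_mul_eq hcoef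
    (b := c * (3 * (n - 5 + 2 * ε) + 3 * (n - 3) - (n - 3) * (n - 2 + 2 * ε))) ?_⟩
  have hself := hp.swapSum_swapSum_apply_self hε hij hik hjk
  change _ = _ + _ * P j k + P i k + P j i at hself
  rw [hc j k hjk, hc i k hik, hc j i hij.symm] at hself
  have hE : ∀ a, a ∉ ({i, j, k} : Finset (Fin n)) →
      (5 - 4 * ε) * p i j k + (n - 2 + 2 * ε) * c - 3 * c - (n - 4) ^ 2 * p i j k =
        (n - 5 + 2 * ε) * (p a j k + p a k i + p a i j) := by
    intro a ha
    simp only [Finset.mem_insert, Finset.mem_singleton, not_or] at ha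
    obtain ⟨hai, haj, hak⟩ := ha
    have h := swapSum_apply_of_ne (f := _root_.swapSum a p) hij hik hjk hai haj hak
    have hq := hp.swapSum a
    rw [← hD i, hself, swapSum_apply_of_ne hij hik hjk hai haj hak, hq.cyc i a k, ← hq.cyc a i j,
      hp.cyc i a k, ← hp.cyc a i j, hp.swapSum_apply_self haj hak hjk,
      hp.swapSum_apply_self hak hai hik.symm, hp.swapSum_apply_self hai haj hij] at h
    change _ = _ + P j k + (_ + P k i) + (_ + P i j) + _ at h
    rw [hc j k hjk, hc k i hik.symm, hc i j hij] at h
    linear_combination h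
  have hsum := Finset.sum_univ_eq_add_sum_sub {i, j, k} hE
  rw [Finset.sum_insert (by simp [hij, hik]), Finset.sum_pair hjk, ← Finset.mul_sum] at hsum
  simp only [Finset.sum_add_distrib, Finset.sum_const, Finset.card_univ, Fintype.card_fin,
    nsmul_eq_mul, hp.diag, hp.diag₁₃] at hsum
  rw [← hp.cyc i j k, hp.cyc k i j] at hsum
  change _ = _ * (P j k + P k i + P i j) + _ at hsum
  rw [hc j k hjk, hc k i hik.symm, hc i j hij] at hsum
  linear_combination hsum

end IsSignSymm

namespace Equiv.Perm

variable {ι : Type*} [DecidableEq ι]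

theorem swap_mul_swap_rotate {i j k : ι} (hij : i ≠ j) (hik : i ≠ k) :
    swap i j * swap j k = swap j k * swap k i := by
  rw [Equiv.mul_swap_eq_swap_mul (swap j k) k i, Equiv.swap_apply_right,
    Equiv.swap_apply_of_ne_of_ne hij hik, Equiv.swap_comm j i]

theorem swap_mul_swap_inv {i j k : ι} (hij : i ≠ j) (hik : i ≠ k) :
    (swap i j * swap j k)⁻¹ = swap i k * swap k j := by
  rw [mul_inv_rev, Equiv.swap_inv, Equiv.swap_inv, Equiv.mul_swap_eq_swap_mul (swap j k) i j,
    Equiv.swap_apply_left, Equiv.swap_apply_of_ne_of_ne hij hik, Equiv.swap_comm j k]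

theorem swap_mul_swap_apply_left {i j k : ι} (hij : i ≠ j) (hik : i ≠ k) :
    (swap i j * swap j k) i = j := by
  rw [Perm.mul_apply, Equiv.swap_apply_of_ne_of_ne hij hik, Equiv.swap_apply_left]

theorem swap_mul_swap_ne_inv {i j k : ι} (hij : i ≠ j) (hik : i ≠ k) (hjk : j ≠ k) :
    swap i j * swap j k ≠ swap i k * swap k j := fun h => by
  have := DFunLike.congr_fun h i
  rw [swap_mul_swap_apply_left hij hik, swap_mul_swap_apply_left hik hij] at this
  exact hjk this

theorem swap_mul_swap_sq {i j k : ι} (hij : i ≠ j) (hik : i ≠ k) (hjk : j ≠ k) :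
    (swap i j * swap j k) * (swap i j * swap j k) = swap i k * swap k j := by
  nth_rw 2 [swap_mul_swap_rotate hij hik]
  rw [mul_assoc, Equiv.swap_mul_self_mul, Equiv.swap_comm k i, Equiv.swap_comm i j,
    swap_mul_swap_rotate hij.symm hjk]

end Equiv.Perm

namespace Representation

variable {n : ℕ} {V : Type} [AddCommGroup V] [Module ℂ V]
  (ρ : Representation ℂ (alternatingGroup (Fin n)) V)

/-- The extension by zero of a representation of `A_n` to `S_n`. -/
noncomputable def permExtend (π : Equiv.Perm (Fin n)) : Module.End ℂ V :=
  if h : Equiv.Perm.sign π = 1 then ρ ⟨π, h⟩ else 0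

theorem permExtend_coe (g : alternatingGroup (Fin n)) : ρ.permExtend g = ρ g := by
  exact dif_pos g.2

theorem permExtend_mul {π σ : Equiv.Perm (Fin n)} (hπ : Equiv.Perm.sign π = 1)
    (hσ : Equiv.Perm.sign σ = 1) : ρ.permExtend (π * σ) = ρ.permExtend π * ρ.permExtend σ := by
  rw [permExtend, permExtend, permExtend, dif_pos hπ, dif_pos hσ,
    dif_pos (by rw [map_mul, hπ, hσ, one_mul])]
  exact map_mul ρ ⟨π, hπ⟩ ⟨σ, hσ⟩

theorem permExtend_injective (hρ : Function.Injective ρ) {π σ : Equiv.Perm (Fin n)}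
    (hπ : Equiv.Perm.sign π = 1) (hσ : Equiv.Perm.sign σ = 1)
    (h : ρ.permExtend π = ρ.permExtend σ) : π = σ := by
  rw [permExtend, permExtend, dif_pos hπ, dif_pos hσ] at h
  exact congr_arg Subtype.val (hρ h)

/-- The sum of the conjugations by the products of two transpositions moving `a`. -/
noncomputable def conjFamily (a : Fin n) : Module.End ℂ V →ₗ[ℂ] Module.End ℂ V :=
  ∑ c ∈ Finset.univ.erase a, ∑ d ∈ Finset.univ.erase a,
    LinearMap.mulLeft ℂ (ρ.permExtend (Equiv.swap a d * Equiv.swap a c)) ∘ₗ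
      LinearMap.mulRight ℂ (ρ.permExtend (Equiv.swap a c * Equiv.swap a d))

theorem conjFamily_apply (a : Fin n) (X : Module.End ℂ V) :
    ρ.conjFamily a X = ∑ c ∈ Finset.univ.erase a, ∑ d ∈ Finset.univ.erase a,
      ρ.permExtend (Equiv.swap a d * Equiv.swap a c) * X *
        ρ.permExtend (Equiv.swap a c * Equiv.swap a d) := by
  simp [conjFamily, LinearMap.sum_apply, mul_assoc]

theorem sign_swap_mul_swap {a b c d : Fin n} (hab : a ≠ b) (hcd : c ≠ d) :
    Equiv.Perm.sign (Equiv.swap a b * Equiv.swap c d) = 1 := by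
  simp [hab, hcd]

theorem linHom_conjFamily (g : alternatingGroup (Fin n)) (a : Fin n) :
    linHom (linHom ρ ρ) (linHom ρ ρ) g (ρ.conjFamily a) = ρ.conjFamily (g.1 a) := by
  refine LinearMap.ext fun X => ?_
  rw [linHom_apply, LinearMap.comp_apply, LinearMap.comp_apply, linHom_apply, linHom_apply]
  change ρ g * ((ρ.conjFamily a) (ρ g⁻¹ * (X * ρ g⁻¹⁻¹)) * ρ g⁻¹) = _
  rw [conjFamily_apply, conjFamily_apply, inv_inv]
  simp only [Finset.sum_mul, Finset.mul_sum]
  have hmem : ∀ c, c ∈ Finset.univ.erase a ↔ g.1 c ∈ Finset.univ.erase (g.1 a) := by simp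
  refine Finset.sum_equiv g.1 hmem fun c hc => Finset.sum_equiv g.1 hmem fun d hd => ?_
  have hc' := (Finset.ne_of_mem_erase hc).symm
  have hd' := (Finset.ne_of_mem_erase hd).symm
  have hconj : ∀ c d, a ≠ c → a ≠ d →
      ρ.permExtend (Equiv.swap (g.1 a) (g.1 d) * Equiv.swap (g.1 a) (g.1 c)) =
        ρ g * ρ.permExtend (Equiv.swap a d * Equiv.swap a c) * ρ g⁻¹ := by
    intro c d hc hd
    rw [← permExtend_coe, ← permExtend_coe, ← ρ.permExtend_mul g.2 (sign_swap_mul_swap hd hc),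
      ← ρ.permExtend_mul (by rw [map_mul, sign_swap_mul_swap hd hc, g.2, one_mul]) (g⁻¹).2]
    congr 1
    rw [← mul_assoc, Equiv.mul_swap_eq_swap_mul g.1, mul_assoc (Equiv.swap _ _),
      Equiv.mul_swap_eq_swap_mul g.1, mul_assoc, mul_assoc]
    simp
  rw [hconj c d hc' hd', hconj d c hd' hc']
  simp only [mul_assoc]

/-- The action of the three-cycle `(i j k)`, or zero if the points are not distinct. -/
noncomputable def cycleOp (i j k : Fin n) : Module.End ℂ V :=
  if i ≠ j ∧ i ≠ k ∧ j ≠ k then ρ.permExtend (Equiv.swap i j * Equiv.swap j k) else 0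

theorem cycleOp_of_ne {i j k : Fin n} (hij : i ≠ j) (hik : i ≠ k) (hjk : j ≠ k) :
    ρ.cycleOp i j k = ρ.permExtend (Equiv.swap i j * Equiv.swap j k) :=
  if_pos ⟨hij, hik, hjk⟩

theorem cycleOp_rotate (i j k : Fin n) : ρ.cycleOp i j k = ρ.cycleOp j k i := by
  by_cases h : i ≠ j ∧ i ≠ k ∧ j ≠ k
  · rw [cycleOp_of_ne _ h.1 h.2.1 h.2.2, cycleOp_of_ne _ h.2.2 h.1.symm h.2.1.symm,
      Equiv.Perm.swap_mul_swap_rotate h.1 h.2.1]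
  · rw [cycleOp, if_neg h, cycleOp, if_neg fun h' => h ⟨h'.2.1.symm, h'.2.2.symm, h'.1⟩]

theorem conjFamily_cycleOp (a i j k : Fin n) :
    ρ.conjFamily a (ρ.cycleOp i j k) =
      ∑ c ∈ Finset.univ.erase a, ∑ d ∈ Finset.univ.erase a,
        ρ.cycleOp (Equiv.swap a d (Equiv.swap a c i)) (Equiv.swap a d (Equiv.swap a c j))
          (Equiv.swap a d (Equiv.swap a c k)) := by
  rw [conjFamily_apply]
  refine Finset.sum_congr rfl fun c hc => Finset.sum_congr rfl fun d hd => ?_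
  have hc' := (Finset.ne_of_mem_erase hc).symm
  have hd' := (Finset.ne_of_mem_erase hd).symm
  by_cases h : i ≠ j ∧ i ≠ k ∧ j ≠ k
  · rw [cycleOp_of_ne _ h.1 h.2.1 h.2.2, cycleOp_of_ne _ (by simpa using h.1)
      (by simpa using h.2.1) (by simpa using h.2.2),
      ← permExtend_mul _ (sign_swap_mul_swap hd' hc') (sign_swap_mul_swap h.1 h.2.2),
      ← permExtend_mul _ (by rw [map_mul, sign_swap_mul_swap hd' hc',
        sign_swap_mul_swap h.1 h.2.2, one_mul]) (sign_swap_mul_swap hc' hd')]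
    congr 1
    have ht : ∀ x y, (Equiv.swap a d * Equiv.swap a c) * Equiv.swap x y =
        Equiv.swap (Equiv.swap a d (Equiv.swap a c x)) (Equiv.swap a d (Equiv.swap a c y)) *
          (Equiv.swap a d * Equiv.swap a c) := fun x y => Equiv.mul_swap_eq_swap_mul _ x y
    rw [← mul_assoc (_ * _) (Equiv.swap i j), ht,
      mul_assoc (Equiv.swap _ _) (_ * _) (Equiv.swap j k),
      ht, mul_assoc, mul_assoc, mul_assoc (Equiv.swap a d), Equiv.swap_mul_self_mul,
      Equiv.swap_mul_self, mul_one]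
  · rw [cycleOp, if_neg h, cycleOp, if_neg (by simpa using h), mul_zero, zero_mul]

/-- If `conjFamily` is constant, then so are the symmetrized (or antisymmetrized) actions of
three-cycles. -/
theorem cycleOp_add_smul_eq (hn : 5 ≤ n) (hconst : ∀ a b, ρ.conjFamily a = ρ.conjFamily b)
    {ε : ℂ} (hε : ε ^ 2 = 1) (hnε : (n : ℂ) - 4 + ε ≠ 0)
    (hcoef : ((n : ℂ) - 3) * (5 - 4 * ε) + 3 * (n - 5 + 2 * ε) - (n - 3) * (n - 4) ^ 2 ≠ 0)
    {i j k i' j' k' : Fin n} (hij : i ≠ j) (hik : i ≠ k) (hjk : j ≠ k) (hij' : i' ≠ j')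
    (hik' : i' ≠ k') (hjk' : j' ≠ k') :
    ρ.cycleOp i j k + ε • ρ.cycleOp i k j = ρ.cycleOp i' j' k' + ε • ρ.cycleOp i' k' j' := by
  rw [← sub_eq_zero, ← Module.forall_dual_apply_eq_zero_iff ℂ]
  intro l
  let p : Fin n → Fin n → Fin n → ℂ := fun i j k => l (ρ.cycleOp i j k + ε • ρ.cycleOp i k j)
  have hp : IsSignSymm ε p :=
    { cyc := fun i j k => by
        simp only [p]
        rw [ρ.cycleOp_rotate i j k, ρ.cycleOp_rotate j i k]
      swap := fun i j k => by
        simp only [p, map_add, map_smul, smul_eq_mul]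
        linear_combination (-l (ρ.cycleOp i k j)) * hε
      diag := fun i k => by simp [p, cycleOp] }
  have hpD : ∀ a i j k, swapSum a (swapSum a p) i j k =
      l (ρ.conjFamily a (ρ.cycleOp i j k + ε • ρ.cycleOp i k j)) := fun a i j k => by
    rw [map_add, map_smul, conjFamily_cycleOp, conjFamily_cycleOp]
    simp only [swapSum, p, Finset.smul_sum, ← Finset.sum_add_distrib, map_sum]
  obtain ⟨C, hC⟩ := hp.exists_eq_const hn hε (fun a b i j k => by rw [hpD, hpD, hconst a b])
    hnε hcoef
  rw [map_sub, sub_eq_zero]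
  exact (hC i j k hij hik hjk).trans (hC i' j' k' hij' hik' hjk').symm

theorem exists_conjFamily_ne (hn : 5 ≤ n) (hρ : Function.Injective ρ) :
    ∃ a b, ρ.conjFamily a ≠ ρ.conjFamily b := by
  by_contra! hconst
  let x : Fin n := ⟨0, by omega⟩
  let y : Fin n := ⟨1, by omega⟩
  let z : Fin n := ⟨2, by omega⟩
  let w : Fin n := ⟨3, by omega⟩
  have hxy : x ≠ y := by simp [x, y]
  have hxz : x ≠ z := by simp [x, z]
  have hxw : x ≠ w := by simp [x, w]
  have hyz : y ≠ z := by simp [y, z]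
  have hyw : y ≠ w := by simp [y, w]
  have hzw : z ≠ w := by simp [z, w]
  by_cases h6 : n = 6
  · have h := ρ.cycleOp_add_smul_eq hn hconst (ε := -1) (by norm_num) (by subst h6; norm_num)
      (by subst h6; norm_num) hxy hxz hyz hxz hxy hyz.symm
    have h2 : ρ.cycleOp x y z = ρ.cycleOp x z y := by
      have h3 : (2 : ℂ) • (ρ.cycleOp x y z - ρ.cycleOp x z y) = 0 := by
        rw [← sub_eq_zero.mpr h]
        module
      exact sub_eq_zero.mp ((smul_eq_zero.mp h3).resolve_left two_ne_zero)
    rw [cycleOp_of_ne _ hxy hxz hyz, cycleOp_of_ne _ hxz hxy hyz.symm] at h2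
    exact Equiv.Perm.swap_mul_swap_ne_inv hxy hxz hyz (ρ.permExtend_injective hρ
      (sign_swap_mul_swap hxy hyz) (sign_swap_mul_swap hxz hyz.symm) h2)
  · have h3 : (n : ℂ) - 3 ≠ 0 := sub_ne_zero.mpr (by exact_mod_cast (by omega : n ≠ 3))
    have h2 : (n : ℂ) - 2 ≠ 0 := sub_ne_zero.mpr (by exact_mod_cast (by omega : n ≠ 2))
    have h6' : (n : ℂ) - 6 ≠ 0 := sub_ne_zero.mpr (by exact_mod_cast h6)
    let a := Equiv.swap x y * Equiv.swap y z
    let a' := Equiv.swap x z * Equiv.swap z y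
    let b := Equiv.swap x w * Equiv.swap w y
    let b' := Equiv.swap x y * Equiv.swap y w
    have ha : Equiv.Perm.sign a = 1 := sign_swap_mul_swap hxy hyz
    have ha' : Equiv.Perm.sign a' = 1 := sign_swap_mul_swap hxz hyz.symm
    have hb : Equiv.Perm.sign b = 1 := sign_swap_mul_swap hxw hyw.symm
    have hb' : Equiv.Perm.sign b' = 1 := sign_swap_mul_swap hxy hyw
    have h := ρ.cycleOp_add_smul_eq hn hconst (ε := 1) (by norm_num)
      (by convert h3 using 1; ring)
      (by convert neg_ne_zero.mpr (mul_ne_zero (mul_ne_zero h3 h2) h6') using 1; ring)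
      hxy hxz hyz hxw hxy hyw.symm
    rw [cycleOp_of_ne _ hxy hxz hyz, cycleOp_of_ne _ hxz hxy hyz.symm,
      cycleOp_of_ne _ hxw hxy hyw.symm, cycleOp_of_ne _ hxy hxw hyw, one_smul, one_smul] at h
    change ρ.permExtend a + ρ.permExtend a' = ρ.permExtend b + ρ.permExtend b' at h
    have hinv : a⁻¹ = a' := Equiv.Perm.swap_mul_swap_inv hxy hxz
    have hinvb : b⁻¹ = b' := Equiv.Perm.swap_mul_swap_inv hxw hxy
    have haa : a * a = a' := Equiv.Perm.swap_mul_swap_sq hxy hxz hyz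
    have hbb : b * b = b' := Equiv.Perm.swap_mul_swap_sq hxw hxy hyw.symm
    have hbb' : b' * b = 1 := by rw [← hinvb, inv_mul_cancel]
    have hb'b : b * b' = 1 := by rw [← hinvb, mul_inv_cancel]
    have haa' : a' * a = 1 := by rw [← hinv, inv_mul_cancel]
    have ha'a : a * a' = 1 := by rw [← hinv, mul_inv_cancel]
    have hv : a' * b = b' * a := by
      ext t
      simp only [a, a', b, b', Equiv.Perm.mul_apply, Equiv.swap_apply_def]
      grind
    have hv' : a * b' = b * a' := by
      ext t
      simp only [a, a', b, b', Equiv.Perm.mul_apply, Equiv.swap_apply_def]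
      grind
    have e₁ := congr_arg (· * ρ.permExtend b) h
    have e₂ := congr_arg (ρ.permExtend a * ·) h
    have e₃ := congr_arg (· * ρ.permExtend a) h
    have e₄ := congr_arg (ρ.permExtend b * ·) h
    simp only [add_mul, mul_add, ← ρ.permExtend_mul, ha, ha', hb, hb', haa, hbb, hbb', hb'b, haa',
      ha'a, hv, hv'] at e₁ e₂ e₃ e₄
    have h₂ : (2 : ℂ) • (ρ.permExtend a' - ρ.permExtend b') = 0 := by
      have e := congr_arg₂ (· + ·) (congr_arg₂ (· + ·) e₁ e₂) (congr_arg₂ (· + ·) e₃ e₄)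
      rw [← sub_eq_zero.mpr e]
      module
    have heq := ρ.permExtend_injective hρ ha' hb'
      (sub_eq_zero.mp ((smul_eq_zero.mp h₂).resolve_left two_ne_zero))
    have := DFunLike.congr_fun heq x
    rw [Equiv.Perm.swap_mul_swap_apply_left hxz hxy, Equiv.Perm.swap_mul_swap_apply_left hxy hxw]
      at this
    exact hyz this.symm

variable (s : Equiv.Perm (Fin n)) (T : Module.Dual ℂ V ≃ₗ[ℂ] V)

/-- The maps from the dual of `V` to `V` indexed by odd permutations, built from an isomorphism
`T` of the dual with the twist of `V` by the odd involution `s`. -/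
noncomputable def oddMap (π : Equiv.Perm (Fin n)) : Module.Dual ℂ V →ₗ[ℂ] V :=
  ρ.permExtend (π * s) ∘ₗ T

/-- The maps from `V` to its dual which correspond to `oddMap`. -/
noncomputable def oddMapDual (π : Equiv.Perm (Fin n)) : V →ₗ[ℂ] Module.Dual ℂ V :=
  T.symm.toLinearMap ∘ₗ ρ.permExtend (s * π)

variable {s T}

theorem oddMap_of_sign_eq_one (hs : Equiv.Perm.sign s = -1) {π : Equiv.Perm (Fin n)}
    (hπ : Equiv.Perm.sign π = 1) : ρ.oddMap s T π = 0 := by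
  have : ¬ Equiv.Perm.sign (π * s) = 1 := by
    rw [map_mul, hπ, hs]
    decide
  rw [oddMap, permExtend, dif_neg this, LinearMap.zero_comp]

theorem oddMap_comp_oddMapDual_comp_oddMap (hs : Equiv.Perm.sign s = -1) (hss : s * s = 1)
    {π σ τ : Equiv.Perm (Fin n)} (hπ : Equiv.Perm.sign π = -1) (hσ : Equiv.Perm.sign σ = -1)
    (hτ : Equiv.Perm.sign τ = -1) :
    ρ.oddMap s T π ∘ₗ ρ.oddMapDual s T σ ∘ₗ ρ.oddMap s T τ = ρ.oddMap s T (π * σ * τ) := by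
  have h : π * σ * τ * s = π * s * (s * σ) * (τ * s) := by
    rw [← mul_assoc (π * s), mul_assoc π s s, hss, mul_one, mul_assoc (π * σ)]
  refine LinearMap.ext fun v => ?_
  have h₁ := ρ.permExtend_mul (π := π * s) (σ := s * σ) (by simp [hs, hπ]) (by simp [hs, hσ])
  have h₂ := ρ.permExtend_mul (π := π * s * (s * σ)) (σ := τ * s) (by simp [hs, hπ, hσ])
    (by simp [hs, hτ])
  rw [oddMap, oddMap, oddMap, oddMapDual, h, h₂, h₁]
  simp

theorem comp_oddMap_comp_dual (hs : Equiv.Perm.sign s = -1) (hss : s * s = 1)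
    (hT : ∀ g : alternatingGroup (Fin n), T.toLinearMap ∘ₗ ρ.dual g =
      ρ.permExtend (s * g * s) ∘ₗ T.toLinearMap)
    (g : alternatingGroup (Fin n)) {π : Equiv.Perm (Fin n)} (hπ : Equiv.Perm.sign π = -1) :
    ρ g ∘ₗ ρ.oddMap s T π ∘ₗ ρ.dual g⁻¹ = ρ.oddMap s T (g * π * g⁻¹) := by
  have hg : Equiv.Perm.sign g.1 = 1 := g.2
  have h : (g * π * g⁻¹ * s : Equiv.Perm (Fin n)) = g * (π * s) * (s * (g⁻¹).1 * s) := by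
    rw [mul_assoc s, ← mul_assoc (g.1 * (π * s)) s, ← mul_assoc g.1, mul_assoc _ s s, hss, mul_one]
    simp only [mul_assoc]
  have h₁ := ρ.permExtend_mul (π := g.1) (σ := π * s) hg (by simp [hs, hπ])
  have h₂ := ρ.permExtend_mul (π := g.1 * (π * s)) (σ := s * (g⁻¹).1 * s) (by simp [hs, hπ, hg])
    (by simp [hs, hg])
  rw [oddMap, oddMap, LinearMap.comp_assoc, hT, h, h₂, h₁, permExtend_coe]
  rfl

variable (s T)

/-- The sum of the conjugations by the odd maps attached to the transpositions moving `a`. -/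
noncomputable def oddFamily (a : Fin n) :
    (V →ₗ[ℂ] Module.Dual ℂ V) →ₗ[ℂ] (Module.Dual ℂ V →ₗ[ℂ] V) :=
  ∑ c ∈ Finset.univ.erase a,
    LinearMap.llcomp ℂ _ _ _ (ρ.oddMap s T (Equiv.swap a c)) ∘ₗ
      LinearMap.lcomp ℂ _ (ρ.oddMap s T (Equiv.swap a c))

variable {s T}

theorem oddFamily_apply (a : Fin n) (X : V →ₗ[ℂ] Module.Dual ℂ V) :
    ρ.oddFamily s T a X = ∑ c ∈ Finset.univ.erase a,
      ρ.oddMap s T (Equiv.swap a c) ∘ₗ X ∘ₗ ρ.oddMap s T (Equiv.swap a c) := by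
  rw [oddFamily, LinearMap.sum_apply]
  rfl

theorem linHom_oddFamily (hs : Equiv.Perm.sign s = -1) (hss : s * s = 1)
    (hT : ∀ g : alternatingGroup (Fin n), T.toLinearMap ∘ₗ ρ.dual g =
      ρ.permExtend (s * g * s) ∘ₗ T.toLinearMap)
    (g : alternatingGroup (Fin n)) (a : Fin n) :
    linHom (linHom ρ ρ.dual) (linHom ρ.dual ρ) g (ρ.oddFamily s T a) =
      ρ.oddFamily s T (g.1 a) := by
  refine LinearMap.ext fun X => LinearMap.ext fun f => ?_
  rw [linHom_apply, LinearMap.comp_apply, LinearMap.comp_apply, linHom_apply, linHom_apply,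
    oddFamily_apply, oddFamily_apply, inv_inv]
  simp only [LinearMap.comp_apply, LinearMap.sum_apply, map_sum]
  refine Finset.sum_equiv g.1 (by simp) fun c hc => ?_
  have hconj : (Equiv.swap (g.1 a) (g.1 c) : Equiv.Perm (Fin n)) =
      g.1 * Equiv.swap a c * (g⁻¹).1 := by
    rw [Equiv.mul_swap_eq_swap_mul]
    simp
  rw [hconj, ← ρ.comp_oddMap_comp_dual hs hss hT g
    (Equiv.Perm.sign_swap (Finset.ne_of_mem_erase hc).symm)]
  simp only [LinearMap.comp_apply]

theorem oddFamily_oddMapDual (hs : Equiv.Perm.sign s = -1) (hss : s * s = 1) (a : Fin n)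
    {i j : Fin n} (hij : i ≠ j) :
    ρ.oddFamily s T a (ρ.oddMapDual s T (Equiv.swap i j)) =
      ∑ c, ρ.oddMap s T (Equiv.swap (Equiv.swap a c i) (Equiv.swap a c j)) -
        ρ.oddMap s T (Equiv.swap i j) := by
  rw [oddFamily_apply, ← Finset.sum_erase_add _ _ (Finset.mem_univ a), Equiv.swap_self,
    _root_.Equiv.refl_apply, _root_.Equiv.refl_apply, add_sub_cancel_right]
  refine Finset.sum_congr rfl fun c hc => ?_
  have hac := Equiv.Perm.sign_swap (Finset.ne_of_mem_erase hc).symm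
  rw [ρ.oddMap_comp_oddMapDual_comp_oddMap hs hss hac (Equiv.Perm.sign_swap hij) hac,
    Equiv.mul_swap_eq_swap_mul (Equiv.swap a c) i j, mul_assoc, Equiv.swap_mul_self, mul_one]

theorem exists_oddFamily_ne (hn : 5 ≤ n) (hρ : Function.Injective ρ)
    (hs : Equiv.Perm.sign s = -1) (hss : s * s = 1) :
    ∃ a b, ρ.oddFamily s T a ≠ ρ.oddFamily s T b := by
  by_contra! hconst
  let x : Fin n := ⟨0, by omega⟩
  let y : Fin n := ⟨1, by omega⟩
  let z : Fin n := ⟨2, by omega⟩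
  have hxy : x ≠ y := by simp [x, y]
  have hxz : x ≠ z := by simp [x, z]
  have hyz : y ≠ z := by simp [y, z]
  have key : ρ.oddMap s T (Equiv.swap x y) = ρ.oddMap s T (Equiv.swap x z) := by
    rw [← sub_eq_zero, ← Module.forall_dual_apply_eq_zero_iff ℂ]
    intro l
    let k : Fin n → Fin n → ℂ := fun i j => l (ρ.oddMap s T (Equiv.swap i j))
    have hk : ∀ i j, k i j = k j i := fun i j => by simp only [k, Equiv.swap_comm]
    have hk0 : ∀ i, k i i = 0 := fun i => by
      simp only [k]
      rw [ρ.oddMap_of_sign_eq_one hs (by simp), map_zero]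
    have hl : ∀ a i j, i ≠ j → l (ρ.oddFamily s T a (ρ.oddMapDual s T (Equiv.swap i j))) =
        ∑ c, k (Equiv.swap a c i) (Equiv.swap a c j) - k i j := fun a i j hij => by
      rw [ρ.oddFamily_oddMapDual hs hss a hij, map_sub, map_sum]
    have hself : ∀ i j, i ≠ j →
        l (ρ.oddFamily s T i (ρ.oddMapDual s T (Equiv.swap i j))) = ∑ c, k c j := by
      intro i j hij
      rw [hl i i j hij, Finset.sum_univ_eq_add_sum_sub {j} (h := fun c => k c j)]
      · simp [hk0, hk j i]
      · intro c hc
        rw [Equiv.swap_apply_left, Equiv.swap_apply_of_ne_of_ne hij.symm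
          (Ne.symm (by simpa using hc))]
    have hother : ∀ a i j, i ≠ j → a ≠ i → a ≠ j →
        l (ρ.oddFamily s T a (ρ.oddMapDual s T (Equiv.swap i j))) =
          k a j + k i a + (n - 3) * k i j := by
      intro a i j hij hai haj
      rw [hl a i j hij, Finset.sum_univ_eq_add_sum_sub {i, j} (h := fun _ => k i j)]
      · rw [Finset.sum_pair hij, Equiv.swap_apply_right, Equiv.swap_apply_right,
          Equiv.swap_apply_of_ne_of_ne haj.symm hij.symm,
          Equiv.swap_apply_of_ne_of_ne hai.symm hij]
        simp only [Finset.sum_const, Finset.card_univ, Fintype.card_fin, nsmul_eq_mul]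
        ring
      · intro c hc
        simp only [Finset.mem_insert, Finset.mem_singleton, not_or] at hc
        rw [Equiv.swap_apply_of_ne_of_ne hai.symm (Ne.symm hc.1),
          Equiv.swap_apply_of_ne_of_ne haj.symm (Ne.symm hc.2)]
    have hrow : ∀ i j, i ≠ j → ∑ c, k c j = ∑ c, k c i := fun i j hij => by
      rw [← hself i j hij, hconst i j, Equiv.swap_comm i j, hself j i hij.symm]
    have h₁ := hother z x y hxy hxz.symm hyz.symm
    have h₂ := hother y x z hxz hxy.symm hyz
    rw [hconst z x, hself x y hxy] at h₁
    rw [hconst y x, hself x z hxz, hrow y z hyz, h₁, hk z y] at h₂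
    have h : ((n : ℂ) - 4) * (k x y - k x z) = 0 := by linear_combination h₂
    have hn4 : (n : ℂ) - 4 ≠ 0 := by
      rw [sub_ne_zero]
      exact_mod_cast (by omega : n ≠ 4)
    rw [map_sub]
    exact (mul_eq_zero.mp h).resolve_left hn4
  have heq : ρ.permExtend (Equiv.swap x y * s) = ρ.permExtend (Equiv.swap x z * s) :=
    (LinearMap.cancel_right T.surjective).mp key
  have h := mul_right_cancel (ρ.permExtend_injective hρ
    (by simp [hs, Equiv.Perm.sign_swap hxy]) (by simp [hs, Equiv.Perm.sign_swap hxz]) heq)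
  exact hyz (by simpa using DFunLike.congr_fun h x)

end Representation

/-- If `χ + χ ∘ e` is real-valued for the irreducible character `χ` of `V`, then the dual of `V`
is isomorphic to `V` or to its twist by `e`. -/
theorem FDRep.nonempty_dual_iso_or {G : Type} [Group G] [Fintype G] (V : FDRep ℂ G)
    [CategoryTheory.Simple V] (e : MulAut G)
    (he : ∀ g, V.character g⁻¹ + V.character (e g⁻¹) = V.character g + V.character (e g)) :
    Nonempty (V ≅ FDRep.of (Representation.dual V.ρ)) ∨
      Nonempty (FDRep.of (Representation.dual V.ρ) ≅
        FDRep.of (MonoidHom.comp V.ρ e.toMonoidHom)) := by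
  have hcard : (Nat.card G : ℂ) ≠ 0 := Nat.cast_ne_zero.mpr Nat.card_pos.ne'
  have : Invertible (Nat.card G : ℂ) := invertibleOfNonzero hcard
  set D := FDRep.of (Representation.dual V.ρ)
  set E := FDRep.of (MonoidHom.comp V.ρ e.toMonoidHom)
  have hV : ∑ g, V.character g * V.character g⁻¹ = Nat.card G :=
    V.simple_iff_char_is_norm_one.mp inferInstance
  have hD : ∀ g, D.character g = V.character g⁻¹ := V.char_dual
  have hE : ∀ g, E.character g = V.character (e g) := fun g => rfl
  have : CategoryTheory.Simple D := by
    rw [FDRep.simple_iff_char_is_norm_one, ← hV]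
    simp only [hD, inv_inv, mul_comm]
  have : CategoryTheory.Simple E := by
    rw [FDRep.simple_iff_char_is_norm_one, ← hV]
    simp only [hE, map_inv]
    exact Equiv.sum_comp e.toEquiv fun g => V.character g * V.character g⁻¹
  by_contra! h
  have hVD := FDRep.char_orthonormal V D
  have hED := FDRep.char_orthonormal D E
  have hVE := FDRep.char_orthonormal V E
  rw [if_neg (not_nonempty_iff.mpr h.1), mul_eq_zero, or_iff_right (inv_ne_zero hcard)] at hVD
  rw [if_neg (not_nonempty_iff.mpr h.2), mul_eq_zero, or_iff_right (inv_ne_zero hcard)] at hED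
  have hED' : ∑ g, V.character g * V.character (e g) = 0 := by
    rw [← hED, ← Equiv.sum_comp (Equiv.inv G)]
    simp [hD, hE]
  have hsum : ∑ g, V.character g * V.character g⁻¹ + ∑ g, V.character g * V.character (e g⁻¹) =
      0 := by
    rw [← Finset.sum_add_distrib]
    simp only [hD, inv_inv] at hVD
    simp only [← mul_add, he]
    simp only [mul_add, Finset.sum_add_distrib, hVD, hED', add_zero]
  simp only [hE] at hVE
  rw [hV] at hsum
  rw [eq_neg_of_add_eq_zero_right hsum, mul_neg, inv_mul_cancel₀ hcard] at hVE
  split_ifs at hVE <;> norm_num at hVE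

/-- A character `χ` of the alternating group becomes real-valued after adding its conjugate by an
odd permutation `s`. -/
theorem FDRep.char_inv_add_char_conj_inv {n : ℕ} (V : FDRep ℂ (alternatingGroup (Fin n)))
    {s : Equiv.Perm (Fin n)} (hs : Equiv.Perm.sign s = -1) (g : alternatingGroup (Fin n)) :
    V.character g⁻¹ + V.character (MulAut.conjNormal s g⁻¹) =
      V.character g + V.character (MulAut.conjNormal s g) := by
  have hconj : ∀ {g h : alternatingGroup (Fin n)} (x : Equiv.Perm (Fin n)),
      Equiv.Perm.sign x = 1 → x * g.1 * x⁻¹ = h.1 → V.character h = V.character g := by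
    intro g h x hx hgh
    rw [← V.char_conj g ⟨x, hx⟩]
    exact congr_arg _ (Subtype.ext hgh.symm)
  obtain ⟨x, hx⟩ := isConj_iff.mp
    (Equiv.Perm.isConj_iff_cycleType_eq.mpr (Equiv.Perm.cycleType_inv g.1).symm)
  rcases Int.units_eq_one_or (Equiv.Perm.sign x) with h | h
  · rw [hconj (g := g) (h := g⁻¹) x h hx,
      hconj (g := MulAut.conjNormal s g) (h := MulAut.conjNormal s g⁻¹) (s * x * s⁻¹) (by simp [h])]
    simp only [MulAut.conjNormal_apply, InvMemClass.coe_inv, ← hx]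
    group
  · rw [hconj (g := MulAut.conjNormal s g) (h := g⁻¹) (x * s⁻¹) (by simp [h, hs]),
      hconj (g := g) (h := MulAut.conjNormal s g⁻¹) (s * x) (by simp [h, hs]), add_comm]
    · simp only [MulAut.conjNormal_apply, InvMemClass.coe_inv, ← hx]
      group
    · simp only [MulAut.conjNormal_apply, InvMemClass.coe_inv, ← hx]
      group

/-- **Theorem 4 (alternating groups).** For `n ≥ 5` and `G = A_n`, every faithful irreducible
character `α` of `G` satisfies `diam M(G,α) ≤ 4n − 4`. -/
theorem mckay_diam_alternatingGroup (n : ℕ) (hn : 5 ≤ n)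
    (α : alternatingGroup (Fin n) → ℂ)
    (hα : IsIrrChar (alternatingGroup (Fin n)) α)
    (hfaithful : IsFaithfulChar (alternatingGroup (Fin n)) α) :
    McKayDiamLE (alternatingGroup (Fin n)) α (4 * n - 4) := by
  obtain ⟨W, hW, hWα⟩ := hα
  obtain ⟨V, hV, hVα⟩ := hfaithful
  have : CategoryTheory.Simple V := by
    rw [FDRep.simple_iff_char_is_norm_one] at hW ⊢
    simpa only [hVα, hWα] using hW
  let s : Equiv.Perm (Fin n) := Equiv.swap ⟨0, by omega⟩ ⟨1, by omega⟩
  have hs : Equiv.Perm.sign s = -1 := Equiv.Perm.sign_swap (by simp)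
  have hss : s * s = 1 := Equiv.swap_mul_self _ _
  let ρ : Representation ℂ (alternatingGroup (Fin n)) V := V.ρ
  have hρ : ∀ g, ρ.character g = α g := hVα
  rw [show 4 * n - 4 = 4 * (n - 1) by omega]
  rcases V.nonempty_dual_iso_or (MulAut.conjNormal s) (V.char_inv_add_char_conj_inv hs) with h | h
  · obtain ⟨i⟩ := h
    have hinv : ∀ g, α g⁻¹ = α g := fun g => by
      rw [← hVα, ← hVα, ← V.char_dual, ← FDRep.char_iso i]
    refine mcKayDiamLE_of_equivariant (by omega) ((ρ.linHom ρ).linHom (ρ.linHom ρ)) ρ.conjFamily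
      ρ.linHom_conjFamily (ρ.exists_conjFamily_ne hn hV) ?_
    ext g
    simp only [Representation.char_linHom, hρ, inv_inv, hinv, Pi.pow_apply]
    ring
  · obtain ⟨i⟩ := h
    let T : Module.Dual ℂ V ≃ₗ[ℂ] V := FDRep.isoToLinearEquiv i
    have hT : ∀ g : alternatingGroup (Fin n), T.toLinearMap ∘ₗ ρ.dual g =
        ρ.permExtend (s * g * s) ∘ₗ T.toLinearMap := by
      intro g
      have hg : (s * g * s : Equiv.Perm (Fin n)) = (MulAut.conjNormal s g).1 := by
        rw [MulAut.conjNormal_apply, inv_eq_of_mul_eq_one_right hss]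
      rw [hg, ρ.permExtend_coe]
      have h : ρ (MulAut.conjNormal s g) = T.conj (ρ.dual g) := FDRep.Iso.conj_ρ i g
      rw [h]
      ext f
      simp [LinearEquiv.conj_apply]
    have hinv : ∀ g, α g⁻¹ = α (MulAut.conjNormal s g) := fun g => by
      rw [← hVα, ← hVα, ← V.char_dual, FDRep.char_iso i]
      rfl
    refine mcKayDiamLE_of_equivariant (by omega) ((ρ.linHom ρ.dual).linHom (ρ.dual.linHom ρ))
      (ρ.oddFamily s T) (ρ.linHom_oddFamily hs hss hT) (ρ.exists_oddFamily_ne hn hV hs hss) ?_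
    ext g
    simp only [Representation.char_linHom, Representation.char_dual, hρ, inv_inv, Pi.pow_apply]
    ring
end

section
/- Let G = PSL_n(q), where q is a power of the prime p, and let g ∈ G be a semisimple element with s := ν(g) satisfying 1 ≤ s < n/2. Then the p-part of the order of the centralizer C_G(g) satisfies (|C_G(g)|_p)² < q^{n² + 2s² − 2ns} (equivalently, |C_G(g)|_p < q^{n²/2 + s² − ns}). -/
open scoped BigOperators

open scoped MatrixGroups

/-- The support of a square matrix `M` over a field `F`: the codimension of the largest
eigenspace of `M` over the algebraic closure of `F`. -/
noncomputable def matrixSupport {n : ℕ} (F : Type) [Field F] (M : Matrix (Fin n) (Fin n) F) : ℕ :=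
  n - ⨆ μ : AlgebraicClosure F, Module.finrank (AlgebraicClosure F)
    (Module.End.eigenspace (Matrix.toLin' (M.map (algebraMap F (AlgebraicClosure F)))) μ)

/-- The `p`-part of a natural number `m`: the largest power of `p` dividing `m`. -/
def pPart (p m : ℕ) : ℕ := p ^ (m.factorization p)

section

open Module

theorem Matrix.rank_map_of_field {n : ℕ} {K L : Type*} [Field K] [Field L] (f : K →+* L)
    (A : Matrix (Fin n) (Fin n) K) : (A.map f).rank = A.rank := by
  classical
  obtain ⟨P, Q, D, hA⟩ := Matrix.Pivot.exists_list_transvec_mul_diagonal_mul_list_transvec A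
  have hdet (l : List (Matrix.TransvectionStruct (Fin n) K)) :
      (l.map Matrix.TransvectionStruct.toMatrix).prod.det = 1 := by
    rw [Matrix.TransvectionStruct.det_toMatrix_prod]
  have hP := hdet P
  have hQ := hdet Q
  generalize (P.map Matrix.TransvectionStruct.toMatrix).prod = U at *
  generalize (Q.map Matrix.TransvectionStruct.toMatrix).prod = W at *
  have hmap : A.map f = U.map f * Matrix.diagonal (fun i => f (D i)) * W.map f := by
    rw [hA, Matrix.map_mul, Matrix.map_mul, Matrix.diagonal_map (map_zero f)]
  have hU : IsUnit (U.map f).det := by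
    have : (U.map f).det = 1 := by rw [← RingHom.mapMatrix_apply, ← RingHom.map_det, hP, map_one]
    simp [this]
  have hW : IsUnit (W.map f).det := by
    have : (W.map f).det = 1 := by rw [← RingHom.mapMatrix_apply, ← RingHom.map_det, hQ, map_one]
    simp [this]
  rw [hmap, hA, Matrix.rank_mul_eq_left_of_isUnit_det _ _ hW,
    Matrix.rank_mul_eq_right_of_isUnit_det _ _ hU,
    Matrix.rank_mul_eq_left_of_isUnit_det _ _ (by simp [hQ]),
    Matrix.rank_mul_eq_right_of_isUnit_det _ _ (by simp [hP]),
    Matrix.rank_diagonal, Matrix.rank_diagonal]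
  simp

theorem Matrix.finrank_eigenspace_add_rank {n : ℕ} {K : Type*} [Field K]
    (A : Matrix (Fin n) (Fin n) K) (μ : K) :
    finrank K (End.eigenspace (Matrix.toLin' A) μ) + (A - Matrix.scalar (Fin n) μ).rank = n := by
  have h := LinearMap.finrank_range_add_finrank_ker (Matrix.toLin' (A - Matrix.scalar (Fin n) μ))
  have h2 : Matrix.toLin' (A - Matrix.scalar (Fin n) μ)
      = Matrix.toLin' A - μ • 1 := by
    rw [map_sub, Matrix.scalar_apply, ← Matrix.smul_one_eq_diagonal, map_smul, Matrix.toLin'_one]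
    rfl
  rw [End.eigenspace_def, ← h2, Matrix.rank, add_comm]
  rwa [finrank_fin_fun] at h

/-- Extending scalars preserves dimensions of eigenspaces, even along a field homomorphism that
fixes the matrix but moves the eigenvalue. -/
theorem Matrix.finrank_eigenspace_map {n : ℕ} {K L : Type*} [Field K] [Field L] (f : K →+* L)
    (A : Matrix (Fin n) (Fin n) K) (μ : K) :
    finrank L (End.eigenspace (Matrix.toLin' (A.map f)) (f μ)) =
      finrank K (End.eigenspace (Matrix.toLin' A) μ) := by
  have h1 := Matrix.finrank_eigenspace_add_rank (A.map f) (f μ)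
  have h2 := Matrix.finrank_eigenspace_add_rank A μ
  have h3 : A.map f - Matrix.scalar (Fin n) (f μ) = (A - Matrix.scalar (Fin n) μ).map f := by
    ext i j
    by_cases hij : i = j <;> simp [Matrix.scalar_apply, hij]
  rw [h3, Matrix.rank_map_of_field] at h1
  omega

theorem Module.End.finrank_eigenspace_add_le {K V : Type*} [Field K] [AddCommGroup V] [Module K V]
    [FiniteDimensional K V] (f : End K V) {μ ν : K} (h : μ ≠ ν) :
    finrank K (f.eigenspace μ) + finrank K (f.eigenspace ν) ≤ finrank K V :=
  Submodule.finrank_add_finrank_le_of_disjoint (f.disjoint_genEigenspace h 1 1)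

theorem Matrix.exists_eigenvalue_of_lt_finrank {n : ℕ} {F : Type*} [Field F] [PerfectField F]
    (A : Matrix (Fin n) (Fin n) F) (μ : AlgebraicClosure F)
    (h : n < 2 * finrank (AlgebraicClosure F) (End.eigenspace
      (Matrix.toLin' (A.map (algebraMap F (AlgebraicClosure F)))) μ)) :
    ∃ l : F, algebraMap F (AlgebraicClosure F) l = μ := by
  have : μ ∈ Set.range (algebraMap F (AlgebraicClosure F)) := by
    rw [InfiniteGalois.mem_range_algebraMap_iff_fixed]
    intro σ
    by_contra hne
    have h1 := Matrix.finrank_eigenspace_map (σ : AlgebraicClosure F →+* AlgebraicClosure F)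
      (A.map (algebraMap F (AlgebraicClosure F))) μ
    have h2 : (A.map (algebraMap F (AlgebraicClosure F))).map
        (σ : AlgebraicClosure F →+* AlgebraicClosure F) =
        A.map (algebraMap F (AlgebraicClosure F)) := by
      ext i j
      simp
    rw [h2] at h1
    have h3 := End.finrank_eigenspace_add_le
      (Matrix.toLin' (A.map (algebraMap F (AlgebraicClosure F)))) hne
    simp only [finrank_fin_fun] at h3
    exact absurd (h3.trans_eq' (congrArg (· + _) h1)) (by omega)
  exact this

theorem Module.End.natCard_units {K V : Type*} [Field K] [AddCommGroup V]
    [Module K V] [FiniteDimensional K V] :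
    Nat.card (End K V)ˣ = Nat.card (GL (Fin (finrank K V)) K) :=
  Nat.card_congr (Units.mapEquiv
    (LinearMap.toMatrixAlgEquiv (finBasis K V)).toMulEquiv).toEquiv

/-- The action of a group on a subspace that it preserves. -/
def Submodule.restrictHom {K V C : Type*} [Field K] [AddCommGroup V] [Module K V] [Group C]
    (ρ : C →* End K V) (W : Submodule K V) (hW : ∀ c, ∀ w ∈ W, ρ c w ∈ W) : C →* (End K W)ˣ :=
  MonoidHom.toHomUnits
    { toFun := fun c => (ρ c).restrict (hW c)
      map_one' := by ext; simp
      map_mul' := fun _ _ => by ext; simp }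

theorem Module.End.natCard_dvd_of_commute {K V C : Type*} [Field K] [AddCommGroup V] [Module K V]
    [FiniteDimensional K V] [Group C] (f : End K V) (hf : f.IsSemisimple) (μ : K)
    (ρ : C →* End K V) (hρ : Function.Injective ρ) (hc : ∀ c, Commute (ρ c) f) :
    Nat.card C ∣ Nat.card (GL (Fin (finrank K (f.eigenspace μ))) K) *
      Nat.card (GL (Fin (finrank K V - finrank K (f.eigenspace μ))) K) := by
  set N : End K V := f - μ • 1 with hN
  have hker : f.eigenspace μ = LinearMap.ker N := End.eigenspace_def
  have hcN (c : C) : Commute (ρ c) N := (hc c).sub_right ((Commute.one_right (ρ c)).smul_right μ)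
  have hcv (c : C) (v : V) : ρ c (N v) = N (ρ c v) := LinearMap.congr_fun (hcN c).eq v
  have hdisj : Disjoint (LinearMap.ker N) (LinearMap.range N) := by
    rw [Submodule.disjoint_def]
    rintro _ hv ⟨w, rfl⟩
    have hw : w ∈ f.genEigenspace μ (2 : ℕ) := by
      rw [End.mem_genEigenspace_nat, ← hN, pow_two]
      exact hv
    rw [hf.isFinitelySemisimple.genEigenspace_eq_eigenspace μ (by norm_num), hker] at hw
    exact hw
  have hdim := LinearMap.finrank_range_add_finrank_ker N
  have hsup : LinearMap.ker N ⊔ LinearMap.range N = ⊤ := by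
    apply Submodule.eq_top_of_disjoint _ _ _ hdisj
    omega
  have hk (c : C) : ∀ w ∈ LinearMap.ker N, ρ c w ∈ LinearMap.ker N := fun w hw => by
    rw [LinearMap.mem_ker] at hw ⊢
    rw [← hcv, hw, map_zero]
  have hr (c : C) : ∀ w ∈ LinearMap.range N, ρ c w ∈ LinearMap.range N := by
    rintro _ ⟨w, rfl⟩
    exact ⟨ρ c w, (hcv c w).symm⟩
  have hinj : Function.Injective ((Submodule.restrictHom ρ _ hk).prod
      (Submodule.restrictHom ρ _ hr)) := by
    intro c d hcd
    rw [MonoidHom.prod_apply, MonoidHom.prod_apply, Prod.mk.injEq] at hcd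
    apply hρ
    ext v
    obtain ⟨x, hx, y, hy, rfl⟩ := Submodule.mem_sup.mp (hsup ▸ Submodule.mem_top : v ∈ _ ⊔ _)
    have h1 : ρ c x = ρ d x :=
      congrArg Subtype.val (LinearMap.congr_fun (congrArg Units.val hcd.1) ⟨x, hx⟩)
    have h2 : ρ c y = ρ d y :=
      congrArg Subtype.val (LinearMap.congr_fun (congrArg Units.val hcd.2) ⟨y, hy⟩)
    rw [map_add, map_add, h1, h2]
  have h := Subgroup.card_dvd_of_injective _ hinj
  rw [Nat.card_prod, End.natCard_units, End.natCard_units] at h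
  rwa [hker, ← hdim, Nat.add_sub_cancel]

theorem Matrix.factorization_card_GL {p f n : ℕ} {F : Type*} [Field F] [Fintype F]
    (hp : p.Prime) (hf : f ≠ 0) (hq : Fintype.card F = p ^ f) :
    (Nat.card (GL (Fin n) F)).factorization p * 2 = f * (n * (n - 1)) := by
  have hterm (i : Fin n) : (Fintype.card F ^ n - Fintype.card F ^ (i : ℕ)).factorization p
      = f * i := by
    have hsplit : Fintype.card F ^ n - Fintype.card F ^ (i : ℕ)
        = p ^ (f * i) * (p ^ (f * (n - i)) - 1) := by
      rw [hq, Nat.mul_sub, mul_one, ← pow_mul, ← pow_mul, ← pow_add, ← Nat.mul_add,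
        Nat.add_sub_cancel' i.2.le]
    have hne : f * (n - i) ≠ 0 := Nat.mul_ne_zero hf (by omega)
    have hlt : 1 < p ^ (f * (n - i)) := Nat.one_lt_pow hne hp.one_lt
    have hnd : ¬ p ∣ p ^ (f * (n - i)) - 1 := fun h => hp.one_lt.ne' <| Nat.dvd_one.mp <|
      (Nat.dvd_sub_iff_right hlt.le (dvd_pow_self p hne)).mp h
    rw [hsplit, Nat.factorization_mul (pow_ne_zero _ hp.ne_zero) (by omega), hp.factorization_pow]
    simp [Nat.factorization_eq_zero_of_not_dvd hnd]
  have hpos (i : Fin n) : Fintype.card F ^ n - Fintype.card F ^ (i : ℕ) ≠ 0 :=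
    (Nat.sub_pos_of_lt (Nat.pow_lt_pow_right Fintype.one_lt_card i.2)).ne'
  rw [Matrix.card_GL_field, Nat.factorization_prod (fun i _ => hpos i), Finsupp.finsetSum_apply,
    Finset.sum_congr rfl (fun i _ => hterm i), ← Finset.mul_sum, mul_assoc,
    Fin.sum_univ_eq_sum_range (fun i => i), Finset.sum_range_id_mul_two]

theorem Matrix.eigenspace_zero_eq_bot {n : ℕ} {F : Type*} [Field F]
    (A : Matrix (Fin n) (Fin n) F) (hA : IsUnit A) : End.eigenspace (Matrix.toLin' A) 0 = ⊥ := by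
  have h := Matrix.finrank_eigenspace_add_rank A 0
  rw [map_zero, sub_zero, Matrix.rank_of_isUnit A hA, Fintype.card_fin] at h
  exact Submodule.finrank_eq_zero.mp (by omega)

/-- If `f` has an eigenspace of more than half the dimension for a nonzero eigenvalue, an injective
endomorphism commuting with `f` up to a scalar commutes with `f`. -/
theorem Module.End.eq_one_of_comp_eq_smul_comp {K V : Type*} [Field K] [AddCommGroup V]
    [Module K V] [FiniteDimensional K V] (f x : End K V) (hx : Function.Injective x) {r μ : K}
    (hμ : μ ≠ 0) (hdim : finrank K V < 2 * finrank K (f.eigenspace μ))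
    (h : f * x = r • (x * f)) : r = 1 := by
  by_contra hr
  have hne : μ ≠ r * μ := fun h' => hr (mul_right_cancel₀ hμ (by rw [← h', one_mul]))
  have hle : (f.eigenspace μ).map x ≤ f.eigenspace (r * μ) := by
    rintro _ ⟨v, hv, rfl⟩
    rw [SetLike.mem_coe, End.mem_eigenspace_iff] at hv
    rw [End.mem_eigenspace_iff]
    have h' := LinearMap.congr_fun h v
    rw [End.mul_apply, LinearMap.smul_apply, End.mul_apply, hv, map_smul, smul_smul] at h'
    exact h'
  have h1 := Submodule.finrank_mono hle
  rw [(Submodule.equivMapOfInjective x hx _).symm.finrank_eq] at h1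
  have h2 := f.finrank_eigenspace_add_le hne
  omega

theorem exists_finrank_eigenspace_eq_of_matrixSupport {n s : ℕ} {F : Type} [Field F]
    (A : Matrix (Fin n) (Fin n) F) (hA : matrixSupport F A = s) (hs : 1 ≤ s) :
    ∃ μ : AlgebraicClosure F, finrank (AlgebraicClosure F) (End.eigenspace
      (Matrix.toLin' (A.map (algebraMap F (AlgebraicClosure F)))) μ) = n - s := by
  obtain ⟨μ, hμ⟩ := Nat.sSup_mem (Set.range_nonempty fun μ : AlgebraicClosure F =>
    finrank (AlgebraicClosure F) (End.eigenspace
      (Matrix.toLin' (A.map (algebraMap F (AlgebraicClosure F)))) μ))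
    ⟨n, by
      rintro _ ⟨μ, rfl⟩
      exact (Submodule.finrank_le _).trans_eq (finrank_fin_fun _)⟩
  refine ⟨μ, hμ.trans ?_⟩
  unfold matrixSupport iSup at hA
  omega

theorem Matrix.isSemisimple_toLin' {n p m : ℕ} {F : Type*} [Field F] [CharP F p]
    (hm : ¬ p ∣ m) (A : Matrix (Fin n) (Fin n) F) {r : F} (hr : r ≠ 0)
    (hA : A ^ m = Matrix.scalar (Fin n) r) : Module.End.IsSemisimple (Matrix.toLin' A) := by
  apply End.isSemisimple_of_squarefree_aeval_eq_zero
    (Polynomial.separable_X_pow_sub_C' p m r hm hr).squarefree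
  have h : Polynomial.aeval (Matrix.toLinAlgEquiv' A) (Polynomial.X ^ m - Polynomial.C r) = 0 := by
    rw [map_sub, map_pow, Polynomial.aeval_X, Polynomial.aeval_C, ← map_pow, hA, sub_eq_zero,
      ← AlgEquiv.commutes (Matrix.toLinAlgEquiv' : Matrix (Fin n) (Fin n) F ≃ₐ[F] _)]
    rfl
  exact h

/-- If `g` has an eigenspace of more than half the dimension, the centralizer of its image in
`PSL` is the image of its centralizer in `SL`. -/
theorem Matrix.SpecialLinearGroup.natCard_centralizer_mk_dvd {n : ℕ} {F : Type*} [Field F]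
    (g : Matrix.SpecialLinearGroup (Fin n) F) {μ : F}
    (hdim : n < 2 * finrank F (End.eigenspace (Matrix.toLin' (g : Matrix (Fin n) (Fin n) F)) μ)) :
    Nat.card (Subgroup.centralizer {(QuotientGroup.mk g : PSL(n, F))}) ∣
      Nat.card (Subgroup.centralizer {g}) := by
  have hunit (x : Matrix.SpecialLinearGroup (Fin n) F) :
      IsUnit (x : Matrix (Fin n) (Fin n) F) := by
    rw [Matrix.isUnit_iff_isUnit_det, x.det_coe]
    exact isUnit_one
  have hμ : μ ≠ 0 := by
    rintro rfl
    rw [Matrix.eigenspace_zero_eq_bot _ (hunit g), finrank_bot] at hdim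
    omega
  let φ : Subgroup.centralizer {g} →* Subgroup.centralizer {(QuotientGroup.mk g : PSL(n, F))} :=
    ((QuotientGroup.mk' (Subgroup.center (Matrix.SpecialLinearGroup (Fin n) F))).comp
      (Subgroup.centralizer {g}).subtype).codRestrict _ fun x => by
        rw [Subgroup.mem_centralizer_singleton_iff]
        exact congrArg QuotientGroup.mk (Subgroup.mem_centralizer_singleton_iff.mp x.2)
  refine Subgroup.card_dvd_of_surjective φ ?_
  rintro ⟨y, hy⟩
  obtain ⟨x, rfl⟩ := QuotientGroup.mk_surjective y
  rw [Subgroup.mem_centralizer_singleton_iff] at hy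
  have hz : (x * g)⁻¹ * (g * x) ∈ Subgroup.center (Matrix.SpecialLinearGroup (Fin n) F) :=
    QuotientGroup.eq.mp hy
  obtain ⟨r, -, hr⟩ := Matrix.SpecialLinearGroup.mem_center_iff.mp hz
  have hgx : (g : Matrix (Fin n) (Fin n) F) * x = r • ((x : Matrix (Fin n) (Fin n) F) * g) := by
    have h : g * x = (x * g) * ((x * g)⁻¹ * (g * x)) := by group
    have h' := congrArg (fun y : Matrix.SpecialLinearGroup (Fin n) F =>
      (y : Matrix (Fin n) (Fin n) F)) h
    simp only [Matrix.SpecialLinearGroup.coe_mul (x * g), ← hr] at h'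
    rw [Matrix.scalar_apply, ← Matrix.smul_one_eq_diagonal, mul_smul_comm, mul_one] at h'
    exact h'
  have hr1 : r = 1 := by
    refine End.eq_one_of_comp_eq_smul_comp (Matrix.toLinAlgEquiv' (g : Matrix (Fin n) (Fin n) F))
      (Matrix.toLinAlgEquiv' (x : Matrix (Fin n) (Fin n) F)) ?_ hμ
      (by rw [finrank_fin_fun]; exact hdim) ?_
    · exact Matrix.mulVec_injective_iff_isUnit.mpr (hunit x)
    · rw [← map_mul, hgx, map_smul, map_mul]
  rw [hr1, one_smul] at hgx
  refine ⟨⟨x, ?_⟩, rfl⟩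
  rw [Subgroup.mem_centralizer_singleton_iff]
  exact Subtype.ext hgx.symm

theorem Matrix.SpecialLinearGroup.natCard_centralizer_dvd {n : ℕ} {F : Type*} [Field F]
    (g : Matrix.SpecialLinearGroup (Fin n) F)
    (hg : Module.End.IsSemisimple (Matrix.toLin' (g : Matrix (Fin n) (Fin n) F))) {μ : F} {a : ℕ}
    (ha : finrank F (End.eigenspace (Matrix.toLin' (g : Matrix (Fin n) (Fin n) F)) μ) = a) :
    Nat.card (Subgroup.centralizer {g}) ∣
      Nat.card (GL (Fin a) F) * Nat.card (GL (Fin (n - a)) F) := by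
  let ρ : Subgroup.centralizer {g} →* End F (Fin n → F) :=
    ((Matrix.toLinAlgEquiv' : Matrix (Fin n) (Fin n) F ≃ₐ[F] End F (Fin n → F)) :
      Matrix (Fin n) (Fin n) F →* End F (Fin n → F)).comp
      ((Units.coeHom _).comp (Matrix.SpecialLinearGroup.toGL.comp
        (Subgroup.centralizer {g}).subtype))
  have h := End.natCard_dvd_of_commute (Matrix.toLin' (g : Matrix (Fin n) (Fin n) F)) hg μ ρ
    (fun x y hxy => Subtype.ext <| Subtype.ext <| Matrix.toLinAlgEquiv'.injective hxy)
    (fun x => by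
      have hx := congrArg (fun y : Matrix.SpecialLinearGroup (Fin n) F =>
        Matrix.toLinAlgEquiv' (y : Matrix (Fin n) (Fin n) F))
        (Subgroup.mem_centralizer_singleton_iff.mp x.2)
      simp only [Matrix.SpecialLinearGroup.coe_mul, map_mul] at hx
      exact hx)
  rwa [finrank_fin_fun, ha] at h

end

/-- **Lemma (small support).** Let `G = PSL_n(q)`, `q` a power of the prime `p`, and let
`g ∈ G` be semisimple with `s = ν(g)`, `1 ≤ s < n/2`. Then
`(|C_G(g)|_p)² < q^{n² + 2s² − 2ns}`. -/
theorem PSL_centralizer_p_part_small_support (n : ℕ) (p q : ℕ)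
    (F : Type) [Field F] [Fintype F] (hp : p.Prime) (hchar : CharP F p)
    (hq : Fintype.card F = q)
    (g : PSL(n, F)) (hss : Nat.Coprime (orderOf g) p)
    (s : ℕ)
    (hs : ∃ ghat : Matrix.SpecialLinearGroup (Fin n) F,
      (QuotientGroup.mk ghat : PSL(n, F)) = g ∧
        matrixSupport F (ghat : Matrix (Fin n) (Fin n) F) = s)
    (hs1 : 1 ≤ s) (hs2 : 2 * s < n) :
    (pPart p (Nat.card (Subgroup.centralizer {g} : Subgroup PSL(n, F)))) ^ 2 <
      q ^ (n ^ 2 + 2 * s ^ 2 - 2 * n * s) := by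
  obtain ⟨ghat, rfl, hsupp⟩ := hs
  obtain ⟨μ', hμ'⟩ := exists_finrank_eigenspace_eq_of_matrixSupport _ hsupp hs1
  obtain ⟨μ, rfl⟩ := Matrix.exists_eigenvalue_of_lt_finrank
    (ghat : Matrix (Fin n) (Fin n) F) μ' (by omega)
  rw [Matrix.finrank_eigenspace_map] at hμ'
  obtain ⟨f, -, hf⟩ := FiniteField.card F p
  have hm : ¬ p ∣ orderOf (QuotientGroup.mk ghat : PSL(n, F)) := fun h =>
    hp.one_lt.ne' (Nat.dvd_one.mp (hss ▸ Nat.dvd_gcd h dvd_rfl))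
  have hcenter : ghat ^ orderOf (QuotientGroup.mk ghat : PSL(n, F)) ∈
      Subgroup.center (Matrix.SpecialLinearGroup (Fin n) F) := by
    rw [← QuotientGroup.eq_one_iff, QuotientGroup.mk_pow, pow_orderOf_eq_one]
  obtain ⟨r, hrn, hr⟩ := Matrix.SpecialLinearGroup.mem_center_iff.mp hcenter
  have hr0 : r ≠ 0 := by
    rintro rfl
    rw [Fintype.card_fin, zero_pow (by omega)] at hrn
    exact zero_ne_one hrn
  have hsemi : Module.End.IsSemisimple (Matrix.toLin' (ghat : Matrix (Fin n) (Fin n) F)) :=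
    Matrix.isSemisimple_toLin' hm _ hr0 (by rw [hr, Matrix.SpecialLinearGroup.coe_pow])
  have hdvd := (ghat.natCard_centralizer_mk_dvd (μ := μ) (by omega)).trans
    (ghat.natCard_centralizer_dvd hsemi hμ')
  have hpos (k : ℕ) : Nat.card (GL (Fin k) F) ≠ 0 := Nat.card_pos.ne'
  have hle := (Nat.factorization_le_iff_dvd Nat.card_pos.ne'
    (mul_ne_zero (hpos _) (hpos _))).mpr hdvd p
  rw [Nat.factorization_mul (hpos _) (hpos _), Finsupp.add_apply] at hle
  have h1 := Matrix.factorization_card_GL (n := n - s) hp f.ne_zero hf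
  have h2 := Matrix.factorization_card_GL (n := n - (n - s)) hp f.ne_zero hf
  obtain ⟨a, rfl⟩ : ∃ a, n = a + s := ⟨n - s, by omega⟩
  have hexp : (a + s) ^ 2 + 2 * s ^ 2 - 2 * (a + s) * s = a ^ 2 + s ^ 2 := by
    apply Nat.sub_eq_of_eq_add
    ring
  rw [hexp, pPart, ← pow_mul, ← hq, hf, ← pow_mul]
  apply Nat.pow_lt_pow_right hp.one_lt
  simp only [Nat.add_sub_cancel, Nat.add_sub_cancel_left] at hle h1 h2
  calc _ ≤ (f : ℕ) * (a * (a - 1) + s * (s - 1)) := by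
        rw [mul_add, ← h1, ← h2, ← add_mul]
        exact Nat.mul_le_mul_right 2 hle
    _ < (f : ℕ) * (a ^ 2 + s ^ 2) := by
        have ha : a * (a - 1) ≤ a ^ 2 := by
          rw [pow_two]
          exact Nat.mul_le_mul_left a (Nat.sub_le a 1)
        have hs : s * (s - 1) < s ^ 2 := by
          rw [pow_two]
          exact Nat.mul_lt_mul_of_pos_left (by omega) (by omega)
        exact Nat.mul_lt_mul_of_pos_left (by omega) f.pos
end

section
/- Let G = PSL_n(q), where q is a power of the prime p, and let s be an integer with 1 ≤ s < n/2. Then the number n_s(G) of semisimple elements g ∈ G with ν(g) = s satisfies n_s(G) < 44.1·q^{s(2n−s)+n−1}. -/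
open scoped BigOperators

open scoped MatrixGroups

namespace Matrix

theorem rank_fromBlocks_one_zero (K : Type*) [Field K] (a b : ℕ) :
    (fromBlocks 1 0 0 0 : Matrix (Fin a ⊕ Fin b) (Fin a ⊕ Fin b) K).rank = a := by
  classical
  rw [← diagonal_one, ← diagonal_zero, fromBlocks_diagonal, rank_diagonal, Fintype.card_subtype]
  have h : (Finset.univ.filter fun i : Fin a ⊕ Fin b ↦
      Sum.elim (fun _ ↦ (1 : K)) (fun _ ↦ 0) i ≠ 0) = Finset.univ.map Function.Embedding.inl := by
    ext i
    cases i <;> simp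
  rw [h]
  simp

/-- The rank of a square matrix does not change under a homomorphism of fields. -/
theorem rank_map_ringHom {K L : Type*} [Field K] [Field L] (f : K →+* L) {m : Type*} [Fintype m]
    [DecidableEq m] (M : Matrix m m K) : (M.map f).rank = M.rank := by
  obtain ⟨V, U, e, hV, hU, h⟩ := exists_rank_normal_form M
  have hV' : IsUnit (f.mapMatrix V).det := (isUnit_iff_isUnit_det _).1 (hV.map f.mapMatrix)
  have hU' : IsUnit (f.mapMatrix U).det := (isUnit_iff_isUnit_det _).1 (hU.map f.mapMatrix)
  have h' := congrArg f.mapMatrix h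
  rw [map_mul, map_mul] at h'
  have h2 : f.mapMatrix (((fromBlocks 1 0 0 0).submatrix e e : Matrix m m K)) =
      (fromBlocks 1 0 0 0).submatrix e e := by
    ext i j
    rcases hi : e i with _ | _ <;> rcases hj : e j with _ | _ <;>
      simp [hi, hj, Matrix.one_apply, apply_ite f]
  rw [h2] at h'
  have h3 := congrArg rank h'
  rw [rank_mul_eq_left_of_isUnit_det _ _ hU', rank_mul_eq_right_of_isUnit_det _ _ hV',
    rank_submatrix, rank_fromBlocks_one_zero] at h3
  exact h3

theorem rank_add_le_rank_add_rank {K m : Type*} [Field K] [Fintype m] (A B : Matrix m m K) :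
    (A + B).rank ≤ A.rank + B.rank := by
  rw [rank, rank, rank, mulVecLin_add]
  exact (Submodule.finrank_mono (LinearMap.range_add_le _ _)).trans
    (Submodule.finrank_add_le_finrank_add_finrank _ _)

theorem finrank_eigenspace_add_rank_s10 {K m : Type*} [Field K] [Fintype m] [DecidableEq m]
    (M : Matrix m m K) (μ : K) :
    Module.finrank K (Module.End.eigenspace (toLin' M) μ) + (M - scalar m μ).rank =
      Fintype.card m := by
  have h : (M - scalar m μ).mulVecLin = toLin' M - μ • 1 := by
    ext v i
    simp [Pi.single_apply]
  rw [Module.End.eigenspace_def, rank, h, add_comm, LinearMap.finrank_range_add_finrank_ker]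
  simp

/-- An element of the algebraic closure of a finite field at which the characteristic matrix has
rank less than half its size belongs to the base field. -/
theorem mem_range_algebraMap_of_two_mul_rank_lt {F m : Type*} [Field F] [Fintype F] [Fintype m]
    [DecidableEq m] (M : Matrix m m F) (μ : AlgebraicClosure F)
    (h : 2 * (M.map (algebraMap F (AlgebraicClosure F)) - scalar m μ).rank < Fintype.card m) :
    μ ∈ Set.range (algebraMap F (AlgebraicClosure F)) := by
  rw [InfiniteGalois.mem_range_algebraMap_iff_fixed]
  intro σ
  by_contra hne
  set N := M.map (algebraMap F (AlgebraicClosure F)) with hN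
  have hmap : (N - scalar m μ).map (σ : AlgebraicClosure F →+* AlgebraicClosure F) =
      N - scalar m (σ μ) := by
    ext i j
    by_cases hij : i = j <;> simp [hN, hij]
  have hr := rank_map_ringHom (σ : AlgebraicClosure F →+* AlgebraicClosure F) (N - scalar m μ)
  rw [hmap] at hr
  have hsum := rank_add_le_rank_add_rank (N - scalar m (σ μ)) (-(N - scalar m μ))
  have hneg : (-(N - scalar m μ)).rank ≤ (N - scalar m μ).rank := by
    have := rank_mul_le_right (-1 : Matrix m m (AlgebraicClosure F)) (N - scalar m μ)
    simpa using this
  have heq : N - scalar m (σ μ) + -(N - scalar m μ) = scalar m (μ - σ μ) := by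
    rw [map_sub]; abel
  have hfull : (scalar m (μ - σ μ)).rank = Fintype.card m := by
    apply rank_of_isUnit
    exact (IsUnit.mk0 _ (sub_ne_zero.2 (Ne.symm hne))).map (scalar m)
  rw [heq, hfull] at hsum
  omega

/-- Matrices of rank `s` are determined by `s` rows and the coefficients of the remaining ones. -/
theorem ncard_rank_eq_le {F : Type*} [Field F] [Fintype F] (n s : ℕ) :
    {M : Matrix (Fin n) (Fin n) F | M.rank = s}.ncard ≤
      n.choose s * Fintype.card F ^ (s * n + (n - s) * s) := by
  classical
  let f (J : Finset (Fin n)) (x : (J → Fin n → F) × ({i // i ∉ J} → J → F)) :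
      Matrix (Fin n) (Fin n) F := fun i ↦
    if h : i ∈ J then x.1 ⟨i, h⟩ else ∑ j, x.2 ⟨i, h⟩ j • x.1 j
  have hsub : {M : Matrix (Fin n) (Fin n) F | M.rank = s} ⊆
      ((Finset.univ.powersetCard s).biUnion fun J ↦ Finset.univ.image (f J) :
        Finset (Matrix (Fin n) (Fin n) F)) := by
    intro M hM
    obtain ⟨κ, a, ha, hspan, hli⟩ := exists_linearIndependent' F M.row
    have : Fintype κ := Fintype.ofInjective a ha
    have hcard : Fintype.card κ = s := by
      rw [← finrank_span_eq_card hli, hspan, ← rank_eq_finrank_span_row]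
      exact hM
    let J : Finset (Fin n) := Finset.univ.image a
    have hJ : J.card = s := by
      rw [Finset.card_image_of_injective _ ha, Finset.card_univ, hcard]
    have hrange : Set.range (M.row ∘ a) = Set.range (fun j : J ↦ M.row j) := by
      ext v
      simp [J]
    have hmem (i : Fin n) : ∃ c : J → F, ∑ j, c j • M.row j = M.row i := by
      rw [← Submodule.mem_span_range_iff_exists_fun, ← hrange, hspan]
      exact Submodule.subset_span ⟨i, rfl⟩
    choose c hc using hmem
    simp only [Finset.coe_biUnion, Set.mem_iUnion, Finset.coe_image, Finset.mem_coe,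
      Finset.mem_powersetCard_univ]
    refine ⟨J, hJ, (fun j ↦ M.row j, fun i ↦ c i), by simp, ?_⟩
    funext i
    by_cases h : i ∈ J
    · simp [f, h, row]
    · simp only [f, h, dite_false]
      exact hc i
  refine (Set.ncard_le_ncard hsub (Finset.finite_toSet _)).trans ?_
  rw [Set.ncard_coe_finset]
  refine (Finset.card_biUnion_le_card_mul _ _ (Fintype.card F ^ (s * n + (n - s) * s)) ?_).trans ?_
  · intro J hJ
    rw [Finset.mem_powersetCard_univ] at hJ
    refine Finset.card_image_le.trans (le_of_eq ?_)
    have hJc : Fintype.card {i // i ∉ J} = n - s := by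
      rw [Fintype.card_subtype_compl, Fintype.card_fin, Fintype.card_coe, hJ]
    simp only [Finset.card_univ, Fintype.card_prod, Fintype.card_fun, Fintype.card_coe, hJ, hJc,
      Fintype.card_fin]
    rw [← pow_mul, ← pow_mul, ← pow_add]
    congr 1
    ring
  · simp

end Matrix

/-- If the support of a matrix is less than half its size, it is the rank of the difference of the
matrix and a scalar matrix over the base field. -/
theorem exists_rank_sub_scalar_eq_matrixSupport {F : Type} [Field F] [Fintype F] {n : ℕ}
    (M : Matrix (Fin n) (Fin n) F) (h : 2 * matrixSupport F M < n) :
    ∃ c : F, (M - Matrix.scalar (Fin n) c).rank = matrixSupport F M := by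
  set N := M.map (algebraMap F (AlgebraicClosure F)) with hN
  have hadd (μ : AlgebraicClosure F) := Matrix.finrank_eigenspace_add_rank_s10 N μ
  simp only [Fintype.card_fin] at hadd
  have hbdd : BddAbove (Set.range fun μ : AlgebraicClosure F ↦ Module.finrank (AlgebraicClosure F)
      (Module.End.eigenspace (Matrix.toLin' N) μ)) := by
    refine ⟨n, ?_⟩
    rintro _ ⟨μ, rfl⟩
    have := hadd μ
    dsimp only
    omega
  obtain ⟨μ, hμ⟩ := Nat.sSup_mem (Set.range_nonempty _) hbdd
  have hsupp : (N - Matrix.scalar (Fin n) μ).rank = matrixSupport F M := by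
    have := hadd μ
    dsimp only at hμ
    rw [matrixSupport, iSup, ← hμ]
    omega
  obtain ⟨c, rfl⟩ := Matrix.mem_range_algebraMap_of_two_mul_rank_lt M μ (by
    rw [hsupp, Fintype.card_fin]; exact h)
  refine ⟨c, ?_⟩
  rw [← hsupp, ← Matrix.rank_map_ringHom (algebraMap F (AlgebraicClosure F))]
  congr 1
  ext i j
  by_cases hij : i = j <;> simp [hN, hij]

theorem ncard_matrixSupport_eq_le {F : Type} [Field F] [Fintype F] {n s : ℕ} (h : 2 * s < n) :
    {M : Matrix (Fin n) (Fin n) F | matrixSupport F M = s}.ncard ≤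
      Fintype.card F * (n.choose s * Fintype.card F ^ (s * n + (n - s) * s)) := by
  have hsub : {M : Matrix (Fin n) (Fin n) F | matrixSupport F M = s} ⊆
      (fun x : F × Matrix (Fin n) (Fin n) F ↦ x.2 + Matrix.scalar (Fin n) x.1) ''
        (Set.univ ×ˢ {N | N.rank = s}) := by
    rintro M rfl
    obtain ⟨c, hc⟩ := exists_rank_sub_scalar_eq_matrixSupport M h
    exact ⟨(c, M - Matrix.scalar (Fin n) c), ⟨Set.mem_univ _, hc⟩, sub_add_cancel _ _⟩
  refine (Set.ncard_le_ncard hsub (Set.toFinite _)).trans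
    ((Set.ncard_image_le (Set.toFinite _)).trans ?_)
  rw [Set.ncard_prod, Set.ncard_univ, Nat.card_eq_fintype_card]
  exact Nat.mul_le_mul_left _ (Matrix.ncard_rank_eq_le n s)

/-- **Lemma (counting elements of small support).** Let `G = PSL_n(q)`, `q` a power of the
prime `p`, and `1 ≤ s < n/2`. Then the number of semisimple `g ∈ G` with `ν(g) = s` is less
than `44.1·q^{s(2n−s)+n−1}`. -/
theorem PSL_card_semisimple_support_lt (n : ℕ) (p q : ℕ)
    (F : Type) [Field F] [Fintype F] (hp : p.Prime) (hchar : CharP F p)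
    (hq : Fintype.card F = q)
    (s : ℕ) (hs1 : 1 ≤ s) (hs2 : 2 * s < n) :
    (Set.ncard {g : PSL(n, F) | Nat.Coprime (orderOf g) p ∧
        ∃ ghat : Matrix.SpecialLinearGroup (Fin n) F,
          (QuotientGroup.mk ghat : PSL(n, F)) = g ∧
            matrixSupport F (ghat : Matrix (Fin n) (Fin n) F) = s} : ℝ) <
      44.1 * (q : ℝ) ^ (s * (2 * n - s) + n - 1) := by
  classical
  have hcard : Set.ncard {g : PSL(n, F) | Nat.Coprime (orderOf g) p ∧
        ∃ ghat : Matrix.SpecialLinearGroup (Fin n) F,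
          (QuotientGroup.mk ghat : PSL(n, F)) = g ∧
            matrixSupport F (ghat : Matrix (Fin n) (Fin n) F) = s} ≤
      q * (n.choose s * q ^ (s * n + (n - s) * s)) := by
    rw [← hq]
    refine le_trans ?_ (ncard_matrixSupport_eq_le hs2)
    refine le_trans ?_ (Set.ncard_le_ncard_of_injOn
      (s := {ghat : Matrix.SpecialLinearGroup (Fin n) F |
        matrixSupport F (ghat : Matrix (Fin n) (Fin n) F) = s})
      (fun ghat ↦ (ghat : Matrix (Fin n) (Fin n) F)) (fun _ h ↦ h)
      Subtype.val_injective.injOn (Set.toFinite _))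
    refine le_trans (Set.ncard_le_ncard ?_ (Set.toFinite _)) (Set.ncard_image_le
      (f := fun ghat ↦ (QuotientGroup.mk ghat : PSL(n, F))) (Set.toFinite _))
    rintro g ⟨-, ghat, hg, hs⟩
    exact ⟨ghat, hs, hg⟩
  have hq2 : 2 ≤ q := hq ▸ Fintype.one_lt_card
  have hbound : q * (n.choose s * q ^ (s * n + (n - s) * s)) ≤
      4 * q ^ (s * (2 * n - s) + n - 1) := by
    obtain ⟨k, rfl⟩ : ∃ k, n = s + k + 1 := ⟨n - s - 1, by omega⟩
    have hexp : s * (2 * (s + k + 1) - s) + (s + k + 1) - 1 =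
        1 + (s + k - 1) + (s * (s + k + 1) + (s + k + 1 - s) * s) := by
      rw [show 2 * (s + k + 1) - s = s + 2 * k + 2 by omega, show s + k + 1 - s = k + 1 by omega]
      have : s * (s + 2 * k + 2) = s * (s + k + 1) + (k + 1) * s := by ring
      omega
    have hchoose : (s + k + 1).choose s ≤ 4 * q ^ (s + k - 1) := calc
      (s + k + 1).choose s ≤ 2 ^ (s + k + 1) := Nat.choose_le_two_pow _ _
      _ = 4 * 2 ^ (s + k - 1) := by
        rw [show s + k + 1 = 2 + (s + k - 1) by omega, pow_add]
        norm_num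
      _ ≤ 4 * q ^ (s + k - 1) := by gcongr
    calc
      _ ≤ q * (4 * q ^ (s + k - 1) *
          q ^ (s * (s + k + 1) + (s + k + 1 - s) * s)) := by gcongr
      _ = _ := by rw [hexp, pow_add, pow_add]; ring
  have hpos : (0 : ℝ) < (q : ℝ) ^ (s * (2 * n - s) + n - 1) := by
    have : (0 : ℝ) < q := by exact_mod_cast (by omega : 0 < q)
    positivity
  have hle := Nat.cast_le (α := ℝ) |>.2 (hcard.trans hbound)
  push_cast at hle
  linarith
end

section
/- Let G be a finite group whose center Z(G) has order e, let α be a faithful irreducible character of G, and let ψ be an irreducible character of G with Z(G) contained in the kernel of ψ. If [α^j, ψ]_G ≠ 0 for some integer j ≥ 0, then e divides j. (In particular, in the McKay graph M(G,α), any directed path connecting the trivial character to an irreducible character of G/Z(G) has length divisible by |Z(G)|.) -/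
open scoped BigOperators

/-- A representation of a finite group in characteristic zero whose character is constant is
trivial. -/
theorem Representation.eq_one_of_character_const {k H V : Type*} [Field k] [CharZero k] [Group H]
    [Finite H] [AddCommGroup V] [Module k V] [FiniteDimensional k V] (ρ : Representation k H V)
    (h : ∀ g, ρ.character g = ρ.character 1) (g : H) : ρ g = 1 := by
  cases nonempty_fintype H
  have hcard : (Nat.card H : k) ≠ 0 := Nat.cast_ne_zero.mpr Nat.card_pos.ne'
  let : Invertible (Nat.card H : k) := invertibleOfNonzero hcard
  have hinv := ρ.card_inv_mul_sum_char_eq_finrank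
  simp only [h, ρ.char_one, Finset.sum_const, Finset.card_univ, nsmul_eq_mul,
    ← Nat.card_eq_fintype_card, inv_mul_cancel_left₀ hcard] at hinv
  have htop := Submodule.eq_top_of_finrank_eq (Nat.cast_injective hinv).symm
  ext v
  exact (Representation.mem_invariants ρ v).mp (htop ▸ Submodule.mem_top) g

/-- If the character of a complex representation is constant on a subgroup `K`, then `K` acts
trivially. -/
theorem FDRep.ρ_eq_one_of_character_const {G : Type} [Group G] [Finite G] (V : FDRep ℂ G)
    (K : Subgroup G) (h : ∀ z ∈ K, V.character z = V.character 1) {z : G} (hz : z ∈ K) :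
    V.ρ z = 1 :=
  Representation.eq_one_of_character_const (V.ρ.comp K.subtype)
    (fun g => (h g g.2).trans (congrArg V.character K.subtype.map_one.symm)) ⟨z, hz⟩

/-- **Schur's lemma**: a central element acts on a simple representation as a scalar. -/
theorem FDRep.exists_ρ_eq_smul_of_mem_center {G : Type} [Group G] (V : FDRep ℂ G)
    [CategoryTheory.Simple V] {z : G} (hz : z ∈ Subgroup.center G) :
    ∃ c : ℂ, V.ρ z = c • 1 := by
  let f : V ⟶ V :=
    { hom := Action.ρ V z
      comm := fun g => by
        have := congrArg (Action.ρ V) (Subgroup.mem_center_iff.mp hz g)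
        rw [map_mul, map_mul] at this
        exact this.symm }
  obtain ⟨c, hc⟩ := CategoryTheory.endomorphism_simple_eq_smul_id ℂ f
  exact ⟨c, (congrArg (fun φ : V ⟶ V => φ.hom.hom.hom) hc).symm⟩

theorem FDRep.character_one_ne_zero {G : Type} [Group G] (V : FDRep ℂ G)
    [CategoryTheory.Simple V] : V.character 1 ≠ 0 := by
  rw [V.char_one, Nat.cast_ne_zero]
  intro h
  have : Subsingleton V := Module.finrank_zero_iff.mp h
  refine CategoryTheory.id_nonzero V ?_
  ext v
  exact Subsingleton.elim (α := V) _ _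

/-- The central character of an irreducible character `α`: multiplying the argument of `α` by a
central element multiplies the value of `α` by a scalar. -/
theorem IsIrrChar.exists_central_character {G : Type} [Group G] {α : G → ℂ}
    (hα : IsIrrChar G α) :
    ∃ f : Subgroup.center G →* ℂ, ∀ (z : Subgroup.center G) (g : G),
      α (z * g) = f z * α g := by
  obtain ⟨V, hV, hVα⟩ := hα
  have hα1 : α 1 ≠ 0 := hVα 1 ▸ V.character_one_ne_zero
  have hmul : ∀ z : Subgroup.center G, ∃ c : ℂ, ∀ g, α (z * g) = c * α g := by
    intro z
    obtain ⟨c, hc⟩ := V.exists_ρ_eq_smul_of_mem_center z.2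
    refine ⟨c, fun g => ?_⟩
    simp [← hVα, FDRep.character, hc]
  choose f hf using hmul
  refine ⟨⟨⟨f, ?_⟩, ?_⟩, hf⟩
  · exact mul_right_cancel₀ hα1 (by simp [← hf])
  · intro z w
    exact mul_right_cancel₀ hα1 (by simp [mul_assoc, ← hf])

/-- The central character of a faithful irreducible character is injective. -/
theorem IsFaithfulChar.injective_central_character {G : Type} [Group G] [Finite G] {α : G → ℂ}
    (hα : IsFaithfulChar G α) {f : Subgroup.center G →* ℂ}
    (hf : ∀ (z : Subgroup.center G) (g : G), α (z * g) = f z * α g) : Function.Injective f := by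
  obtain ⟨W, hW, hWα⟩ := hα
  refine (injective_iff_map_eq_one f).mpr fun z hz => Subtype.ext (hW ?_)
  have hker : ∀ x ∈ f.ker.map (Subgroup.center G).subtype, W.character x = W.character 1 := by
    rintro _ ⟨x, hx, rfl⟩
    simpa [hWα, MonoidHom.mem_ker.mp hx] using hf x 1
  simpa using W.ρ_eq_one_of_character_const _ hker ⟨z, hz, rfl⟩

/-- An irreducible character that is constant on the center is invariant under multiplication by
central elements. -/
theorem IsIrrChar.apply_central_mul {G : Type} [Group G] [Finite G] {ψ : G → ℂ}
    (hψ : IsIrrChar G ψ) (hker : ∀ z ∈ Subgroup.center G, ψ z = ψ 1)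
    {z : G} (hz : z ∈ Subgroup.center G) (g : G) : ψ (z * g) = ψ g := by
  obtain ⟨V, -, hVψ⟩ := hψ
  have := V.ρ_eq_one_of_character_const _ (by simpa only [hVψ] using hker) hz
  simp [← hVψ, FDRep.character, this]

/-- If left translation by `z` scales `φ` by `c` and fixes `ψ`, then it scales `[φ,ψ]_G` by `c`,
while the inner product is translation invariant. -/
theorem charInner_eq_mul_of_translate {G : Type} [Group G] [Finite G] {φ ψ : G → ℂ} (z : G) {c : ℂ}
    (hφ : ∀ g, φ (z * g) = c * φ g) (hψ : ∀ g, ψ (z * g) = ψ g) :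
    charInner φ ψ = c * charInner φ ψ := by
  cases nonempty_fintype G
  simp only [charInner, finsum_eq_sum_of_fintype]
  rw [mul_left_comm]
  conv_lhs => rw [← Equiv.sum_comp (Equiv.mulLeft z)]
  simp only [Equiv.coe_mulLeft, hφ, hψ, mul_assoc, Finset.mul_sum]

/-- If `G` has center of order `e`, `α` is a faithful irreducible character of `G`, and `ψ`
is an irreducible character of `G` whose kernel contains `Z(G)`, then `[α^j, ψ]_G ≠ 0`
implies `e ∣ j`. -/
theorem center_divides_path_length (G : Type) [Group G] [Finite G]
    (e : ℕ) (he : Nat.card (Subgroup.center G) = e)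
    (α ψ : G → ℂ) (hαirr : IsIrrChar G α) (hαfaithful : IsFaithfulChar G α)
    (hψ : IsIrrChar G ψ) (hker : ∀ z ∈ Subgroup.center G, ψ z = ψ 1)
    (j : ℕ) (hj : charInner (α ^ j) ψ ≠ 0) :
    e ∣ j := by
  obtain ⟨f, hf⟩ := hαirr.exists_central_character
  have hinj := hαfaithful.injective_central_character hf
  have hcyc : IsCyclic (Subgroup.center G) := isCyclic_of_injective_ringHom f hinj
  obtain ⟨z, hz⟩ := hcyc.exists_ofOrder_eq_natCard
  rw [← he, ← hz, orderOf_dvd_iff_pow_eq_one]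
  apply hinj
  rw [map_pow, map_one]
  have htranslate : charInner (α ^ j) ψ = f z ^ j * charInner (α ^ j) ψ :=
    charInner_eq_mul_of_translate (z : G) (fun g => by simp [hf, mul_pow])
      (hψ.apply_central_mul hker z.2)
  exact (right_eq_mul₀ hj).mp htranslate
end

section
/- Let n ≥ 5 and let G = S_n act naturally on {1,…,n}. Let α be the class function on G given by α(g) = (number of fixed points of g) − 1. Then α is an irreducible character of G (namely χ^{(n−1,1)}), and diam M(G,α) ≤ n−1; that is, for all irreducible characters χ₁, χ₂ of G there exists an integer j with 0 ≤ j ≤ n−1 such that [α^j·χ₁, χ₂]_G ≠ 0. -/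
open scoped BigOperators

theorem charInner_eq_sum {G : Type} [Group G] [Fintype G] (φ ψ : G → ℂ) :
    charInner φ ψ = (Nat.card G : ℂ)⁻¹ * ∑ g : G, φ g * (starRingEnd ℂ) (ψ g) := by
  rw [charInner, finsum_eq_sum_of_fintype]

/-- Burnside–Brauer: if a polynomial of degree at most `d` separates the value of `α` at `1` from
its other values, then the powers of `α` up to the exponent `d` link any two class functions that
do not vanish at `1`. -/
theorem exists_charInner_pow_mul_ne_zero {G : Type} [Group G] [Fintype G] {α χ₁ χ₂ : G → ℂ}
    {d : ℕ} (p : Polynomial ℂ) (hd : p.natDegree ≤ d) (hp : ∀ g ≠ 1, p.eval (α g) = 0)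
    (hp₁ : p.eval (α 1) ≠ 0) (h₁ : χ₁ 1 ≠ 0) (h₂ : χ₂ 1 ≠ 0) :
    ∃ j ≤ d, charInner (α ^ j * χ₁) χ₂ ≠ 0 := by
  by_contra! h
  have hcard : (Nat.card G : ℂ) ≠ 0 := Nat.cast_ne_zero.2 Nat.card_pos.ne'
  have hj : ∀ j ≤ d, ∑ g : G, α g ^ j * χ₁ g * (starRingEnd ℂ) (χ₂ g) = 0 := fun j hj => by
    have := h j hj
    rw [charInner_eq_sum] at this
    simpa [hcard] using this
  have hsum : ∑ g : G, p.eval (α g) * χ₁ g * (starRingEnd ℂ) (χ₂ g) = 0 := by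
    simp_rw [Polynomial.eval_eq_sum_range' (Nat.lt_succ_of_le hd), Finset.sum_mul]
    rw [Finset.sum_comm]
    refine Finset.sum_eq_zero fun j hjd => ?_
    simp_rw [mul_assoc (p.coeff j), ← Finset.mul_sum]
    rw [hj j (Nat.lt_succ_iff.1 (Finset.mem_range.1 hjd)), mul_zero]
  rw [Finset.sum_eq_single 1 (fun g _ hg => by simp [hp g hg]) (by simp)] at hsum
  simp [hp₁, h₁, h₂] at hsum

theorem IsIrrChar.apply_one_ne_zero {G : Type} [Group G] [Finite G] {χ : G → ℂ}
    (h : IsIrrChar G χ) : χ 1 ≠ 0 := by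
  have := Fintype.ofFinite G
  obtain ⟨V, hV, hχ⟩ := h
  rw [← hχ, FDRep.char_one, Nat.cast_ne_zero]
  intro h0
  have : Subsingleton V := Module.finrank_zero_iff.1 h0
  have hzero (g : G) : V.character g = 0 := by
    rw [FDRep.character, Subsingleton.elim (V.ρ g) 0, map_zero]
  have hnorm := V.simple_iff_char_is_norm_one.1 hV
  have hcard : (Nat.card G : ℂ) ≠ 0 := Nat.cast_ne_zero.2 Nat.card_pos.ne'
  exact hcard (by rw [← hnorm]; simp [hzero])

namespace Equiv.Perm

theorem card_filter_forall_mem_apply_eq {β : Type*} [Fintype β] [DecidableEq β] (s : Finset β) :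
    (Finset.univ.filter fun g : Equiv.Perm β => ∀ a ∈ s, g a = a).card =
      (Fintype.card β - s.card).factorial := by
  have h := Fintype.card_congr (Equiv.Perm.subtypeEquivSubtypePerm fun a => a ∉ s)
  rw [Fintype.card_perm, Fintype.card_subtype_compl, Fintype.card_coe] at h
  rw [h, Fintype.card_subtype]
  simp

theorem sum_card_fixed {n : ℕ} (hn : 1 ≤ n) :
    ∑ g : Equiv.Perm (Fin n), (Finset.univ.filter fun x => g x = x).card = n.factorial := by
  simp_rw [Finset.card_filter]
  rw [Finset.sum_comm]
  have h (x : Fin n) : ∑ g : Equiv.Perm (Fin n), (if g x = x then 1 else 0) =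
      (n - 1).factorial := by
    simpa using card_filter_forall_mem_apply_eq {x}
  simp [h, Nat.mul_factorial_pred (by omega : n ≠ 0)]

theorem sum_card_fixed_sq {n : ℕ} (hn : 2 ≤ n) :
    ∑ g : Equiv.Perm (Fin n), (Finset.univ.filter fun x => g x = x).card ^ 2 =
      2 * n.factorial := by
  have h (x y : Fin n) : ∑ g : Equiv.Perm (Fin n),
      (if g x = x then 1 else 0) * (if g y = y then 1 else 0) =
      if x = y then (n - 1).factorial else (n - 2).factorial := by
    have := card_filter_forall_mem_apply_eq {x, y}
    simp_rw [ite_zero_mul_ite_zero, mul_one]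
    rw [← Finset.card_filter]
    split_ifs with hxy
    · simpa [hxy] using this
    · simpa [Finset.card_pair hxy] using this
  simp_rw [Finset.card_filter, sq, Finset.sum_mul_sum]
  rw [Finset.sum_comm]
  simp_rw [Finset.sum_comm (s := (Finset.univ : Finset (Equiv.Perm (Fin n)))), h]
  obtain ⟨m, rfl⟩ := Nat.exists_eq_add_of_le' hn
  simp [Finset.sum_ite, Finset.filter_ne, Finset.filter_eq, Nat.factorial_succ]
  ring

theorem card_fixed_lt_of_ne_one {n : ℕ} {g : Equiv.Perm (Fin n)} (hg : g ≠ 1) :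
    (Finset.univ.filter fun x => g x = x).card < n - 1 := by
  have h := Finset.card_filter_add_card_filter_not (s := Finset.univ) fun x : Fin n => g x = x
  have h2 := two_le_card_support_of_ne_one hg
  rw [Finset.card_univ, Fintype.card_fin] at h
  change 2 ≤ (Finset.univ.filter fun x => ¬ g x = x).card at h2
  omega

end Equiv.Perm

section StandardRepresentation

variable (n : ℕ)

/-- The vectors in `ℂⁿ` whose coordinates sum to zero. -/
def sumZero : Submodule ℂ (Fin n → ℂ) where
  carrier := {v | ∑ i, v i = 0}
  add_mem' {v w} hv hw := by
    simp only [Set.mem_ofPred_eq] at *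
    simp [Finset.sum_add_distrib, hv, hw]
  zero_mem' := by simp
  smul_mem' c v hv := by
    simp only [Set.mem_ofPred_eq] at *
    simp [← Finset.mul_sum, hv]

theorem mem_sumZero {v : Fin n → ℂ} : v ∈ sumZero n ↔ ∑ i, v i = 0 := Iff.rfl

/-- The standard representation of `Sₙ`, on the vectors whose coordinates sum to zero. -/
def standardRep : Representation ℂ (Equiv.Perm (Fin n)) (sumZero n) where
  toFun g := (LinearMap.funLeft ℂ ℂ (g⁻¹ : Equiv.Perm (Fin n))).restrict fun v hv => by
    rw [mem_sumZero] at *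
    rw [← hv]
    exact Equiv.sum_comp g⁻¹ v
  map_one' := rfl
  map_mul' _ _ := rfl

/-- The projection of `ℂⁿ` onto the vectors with coordinate sum zero, along the constant
vectors. -/
noncomputable def sumZeroProj (hn : n ≠ 0) : (Fin n → ℂ) →ₗ[ℂ] sumZero n :=
  LinearMap.codRestrict (sumZero n)
    { toFun := fun v i => v i - (n : ℂ)⁻¹ * ∑ j, v j
      map_add' := fun v w => by ext i; simp [Finset.sum_add_distrib]; ring
      map_smul' := fun c v => by ext i; simp [← Finset.mul_sum]; ring }
    fun v => by simp [mem_sumZero, hn]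

theorem sumZeroProj_comp_subtype (hn : n ≠ 0) :
    sumZeroProj n hn ∘ₗ (sumZero n).subtype = LinearMap.id := by
  ext v i
  have h : ∑ j, v.1 j = 0 := v.2
  simp [sumZeroProj, h]

theorem character_standardRep (hn : n ≠ 0) (g : Equiv.Perm (Fin n)) :
    (standardRep n).character g = ((Finset.univ.filter fun x => g x = x).card : ℂ) - 1 := by
  have hcomp : standardRep n g =
      sumZeroProj n hn ∘ₗ ((sumZero n).subtype ∘ₗ standardRep n g) := by
    rw [← LinearMap.comp_assoc, sumZeroProj_comp_subtype, LinearMap.id_comp]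
  rw [Representation.character, hcomp, LinearMap.trace_comp_comm',
    LinearMap.trace_eq_matrix_trace ℂ (Pi.basisFun ℂ (Fin n)), Matrix.trace]
  have hentry (i : Fin n) : Pi.single (M := fun _ => ℂ) i 1 (Equiv.symm g i) =
      if g i = i then 1 else 0 := by
    simp [Pi.single_apply, Equiv.symm_apply_eq, eq_comm (a := i)]
  simp [standardRep, sumZeroProj, LinearMap.funLeft_apply, hentry, hn]

theorem isIrrChar_card_fixed_sub_one (hn : 2 ≤ n) :
    IsIrrChar (Equiv.Perm (Fin n))
      fun g => ((Finset.univ.filter fun x : Fin n => g x = x).card : ℂ) - 1 := by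
  have hchar (g : Equiv.Perm (Fin n)) : (FDRep.of (standardRep n)).character g =
      ((Finset.univ.filter fun x : Fin n => g x = x).card : ℂ) - 1 :=
    character_standardRep n (by omega) g
  refine ⟨FDRep.of (standardRep n), (FDRep.simple_iff_char_is_norm_one _).2 ?_, hchar⟩
  have hinv (g : Equiv.Perm (Fin n)) : (Finset.univ.filter fun x => g⁻¹ x = x) =
      Finset.univ.filter fun x => g x = x := by
    ext x
    simp only [Finset.mem_filter_univ, Equiv.Perm.inv_eq_iff_eq, eq_comm (a := x)]
  have h₁ : ∑ g : Equiv.Perm (Fin n), ((Finset.univ.filter fun x => g x = x).card : ℂ) =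
      n.factorial := mod_cast Equiv.Perm.sum_card_fixed (by omega)
  have h₂ : ∑ g : Equiv.Perm (Fin n), ((Finset.univ.filter fun x => g x = x).card : ℂ) ^ 2 =
      2 * n.factorial := mod_cast Equiv.Perm.sum_card_fixed_sq hn
  simp_rw [hchar, hinv, ← sq, sub_sq, Finset.sum_add_distrib, Finset.sum_sub_distrib,
    mul_one, ← Finset.mul_sum, h₁, h₂]
  simp [Fintype.card_perm]

end StandardRepresentation

/-- **Step 1.** For `n ≥ 5` and `G = S_n`, the function `α(g) = #fix(g) − 1` is an
irreducible character of `G` (namely `χ^{(n−1,1)}`) and `diam M(G,α) ≤ n − 1`. -/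
theorem mckay_diam_standard_character (n : ℕ) (hn : 5 ≤ n)
    (α : Equiv.Perm (Fin n) → ℂ)
    (hα : α = fun g => ((Finset.univ.filter fun x : Fin n => g x = x).card : ℂ) - 1) :
    IsIrrChar (Equiv.Perm (Fin n)) α ∧ McKayDiamLE (Equiv.Perm (Fin n)) α (n - 1) := by
  subst hα
  refine ⟨isIrrChar_card_fixed_sub_one n (by omega), fun χ₁ χ₂ h₁ h₂ => ?_⟩
  refine exists_charInner_pow_mul_ne_zero
    (∏ k ∈ Finset.range (n - 1), (Polynomial.X - Polynomial.C ((k : ℂ) - 1))) ?_ ?_ ?_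
    h₁.apply_one_ne_zero h₂.apply_one_ne_zero
  · rw [Polynomial.natDegree_finsetProd_X_sub_C_eq_card, Finset.card_range]
  · intro g hg
    rw [Polynomial.eval_prod]
    exact Finset.prod_eq_zero
      (Finset.mem_range.2 (Equiv.Perm.card_fixed_lt_of_ne_one hg)) (by simp)
  · rw [Polynomial.eval_prod, Finset.prod_ne_zero_iff]
    intro k hk
    have hkn : n ≠ k := by have := Finset.mem_range.1 hk; omega
    simpa [sub_eq_zero] using hkn
end
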